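/- Let E ⊆ Γ be a Carleson set. Then J₀⁺(E) ⊆ I for every closed ideal I ≠ {0} of A⁺ such that S_I = 1 and h(I) ⊆ E. -/

import Mathlib

noncomputable section

/-- An invertible contraction on a (complex) Banach space. -/
structure BanachContraction where
  X : Type
  [grp : NormedAddCommGroup X]
  [mod : NormedSpace ℂ X]
  [cpl : CompleteSpace X]
  T : X →L[ℂ] X
  Tinv : X →L[ℂ] X
  norm_le : ‖T‖ ≤ 1
  mul_inv : T * Tinv = 1
  inv_mul : Tinv * T = 1

attribute [instance] BanachContraction.grp BanachContraction.mod BanachContraction.cpl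

open Complex MeasureTheory Metric Set Filter

/-- The `n`-th Taylor coefficient of `f` at `0`, i.e. `f⁽ⁿ⁾(0)/n!`. -/
def taylorCoeff (f : ℂ → ℂ) (n : ℕ) : ℂ := iteratedDeriv n f 0 / (n.factorial : ℂ)

/-- `A⁺`, the algebra of absolutely convergent Taylor series: functions which, on the
closed unit disk, are sums of a power series with absolutely summable coefficients. -/
def APlus : Set (ℂ → ℂ) :=
  {f | ∃ a : ℕ → ℂ, Summable (fun n => ‖a n‖) ∧
    ∀ z ∈ Metric.closedBall (0 : ℂ) 1, HasSum (fun n => a n * z ^ n) (f z)}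

/-- The norm `‖f‖₁ = ∑ₙ |f⁽ⁿ⁾(0)/n!|` on `A⁺`. -/
def APlusNorm (f : ℂ → ℂ) : ℝ := ∑' n : ℕ, ‖taylorCoeff f n‖

/-- The `n`-th Fourier coefficient of (the boundary values of) `f` on the unit circle. -/
def fcoeff (f : ℂ → ℂ) (n : ℤ) : ℂ :=
  (1 / (2 * Real.pi)) * ∫ θ in (0:ℝ)..(2 * Real.pi),
    f (Complex.exp ((θ : ℂ) * Complex.I)) * Complex.exp (-(n : ℂ) * (θ : ℂ) * Complex.I)

/-- The Wiener algebra `A(Γ)` of absolutely convergent Fourier series on the unit circle,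
viewed as functions `ℂ → ℂ` (only the values on the unit circle are relevant). -/
def WienerAlg : Set (ℂ → ℂ) :=
  {f | Summable (fun n : ℤ => ‖fcoeff f n‖) ∧
    ∀ z ∈ Metric.sphere (0 : ℂ) 1, HasSum (fun n : ℤ => fcoeff f n * z ^ n) (f z)}

/-- The norm `‖f‖₁ = ∑_{n ∈ ℤ} |f̂(n)|` on `A(Γ)`. -/
def WienerNorm (f : ℂ → ℂ) : ℝ := ∑' n : ℤ, ‖fcoeff f n‖

/-- `I` is a closed ideal of `A⁺` (closedness w.r.t. the norm `APlusNorm`). -/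
def IsClosedIdealAPlus (I : Set (ℂ → ℂ)) : Prop :=
  I ⊆ APlus ∧
  (∀ f ∈ I, ∀ g ∈ I, f + g ∈ I) ∧
  (∀ f ∈ APlus, ∀ g ∈ I, f * g ∈ I) ∧
  (∀ f ∈ APlus, (∀ ε > 0, ∃ g ∈ I, APlusNorm (f - g) < ε) → f ∈ I)

/-- `J` is a closed ideal of the Wiener algebra `A(Γ)`. -/
def IsClosedIdealW (J : Set (ℂ → ℂ)) : Prop :=
  J ⊆ WienerAlg ∧
  (∀ f ∈ J, ∀ g ∈ J, f + g ∈ J) ∧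
  (∀ f ∈ WienerAlg, ∀ g ∈ J, f * g ∈ J) ∧
  (∀ f ∈ WienerAlg, (∀ ε > 0, ∃ g ∈ J, WienerNorm (f - g) < ε) → f ∈ J)

/-- `I^A` : the closed ideal generated by `I` in the Wiener algebra `A(Γ)`. -/
def IdealGenW (I : Set (ℂ → ℂ)) : Set (ℂ → ℂ) := ⋂₀ {J | IsClosedIdealW J ∧ I ⊆ J}

/-- The hull `h(I)`: common zeros in the closed unit disk of all elements of `I`. -/
def hull (I : Set (ℂ → ℂ)) : Set ℂ :=
  {z ∈ Metric.closedBall (0 : ℂ) 1 | ∀ f ∈ I, f z = 0}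

/-- `I ≠ {0}`: `I` contains an element not identically zero on the unit disk. -/
def NontrivialIdeal (I : Set (ℂ → ℂ)) : Prop :=
  ∃ f ∈ I, ∃ z ∈ Metric.ball (0 : ℂ) 1, f z ≠ 0

/-- `H^∞(D)`: bounded holomorphic functions on the open unit disk. -/
def Hinf : Set (ℂ → ℂ) :=
  {f | DifferentiableOn ℂ f (Metric.ball (0 : ℂ) 1) ∧
    ∃ C : ℝ, ∀ z ∈ Metric.ball (0 : ℂ) 1, ‖f z‖ ≤ C}

/-- An inner function: a bounded-by-one holomorphic function on the unit disk whose
radial limits have modulus `1` at almost every boundary point. -/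
def IsInnerFunction (u : ℂ → ℂ) : Prop :=
  DifferentiableOn ℂ u (Metric.ball (0 : ℂ) 1) ∧
  (∀ z ∈ Metric.ball (0 : ℂ) 1, ‖u z‖ ≤ 1) ∧
  ∀ᵐ (θ : ℝ) ∂(MeasureTheory.volume.restrict (Set.Ioc (0 : ℝ) (2 * Real.pi))),
    Filter.Tendsto (fun r : ℝ => ‖u ((r : ℂ) * Complex.exp ((θ : ℂ) * Complex.I))‖)
      (nhdsWithin 1 (Set.Iio 1)) (nhds 1)

/-- `S` divides (the inner factor of) `f`, i.e. `f ∈ S·H^∞`. -/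
def InnerDivides (S f : ℂ → ℂ) : Prop :=
  ∃ g ∈ Hinf, ∀ z ∈ Metric.ball (0 : ℂ) 1, f z = S z * g z

/-- `S` is a greatest common divisor of the inner factors of the nonzero elements of `I`:
`S` is inner, divides every nonzero element of `I`, and every inner function with this
property divides `S`. -/
def IsGcdInner (I : Set (ℂ → ℂ)) (S : ℂ → ℂ) : Prop :=
  IsInnerFunction S ∧
  (∀ f ∈ I, (∃ z ∈ Metric.ball (0 : ℂ) 1, f z ≠ 0) → InnerDivides S f) ∧
  ∀ S' : ℂ → ℂ, IsInnerFunction S' →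
    (∀ f ∈ I, (∃ z ∈ Metric.ball (0 : ℂ) 1, f z ≠ 0) → InnerDivides S' f) →
    InnerDivides S' S

/-- The perfect symmetric set `E_ξ` of constant ratio `ξ` on the unit circle. -/
def Eset (ξ : ℝ) : Set ℂ :=
  {z | ∃ ε : ℕ → ℕ, (∀ k, ε k ≤ 1) ∧
    z = Complex.exp (2 * Real.pi * Complex.I *
      (((1 - ξ) * ∑' k : ℕ, (ε k : ℝ) * ξ ^ k : ℝ) : ℂ))}

/-- A Carleson set: a closed subset of the unit circle with
`∫_{-π}^{π} log (2 / dist(e^{iθ}, E)) dθ < ∞`. -/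
def IsCarleson (E : Set ℂ) : Prop :=
  IsClosed E ∧ E ⊆ Metric.sphere (0 : ℂ) 1 ∧
  MeasureTheory.IntegrableOn
    (fun θ : ℝ => Real.log (2 / Metric.infDist (Complex.exp ((θ : ℂ) * Complex.I)) E))
    (Set.Ioc (-Real.pi) Real.pi)

/-- The division ideal `I(f) = {g ∈ A⁺ : fg ∈ I}`. -/
def Idiv (I : Set (ℂ → ℂ)) (f : ℂ → ℂ) : Set (ℂ → ℂ) := {g ∈ APlus | f * g ∈ I}

/-- `f` belongs to `A^∞(D)` and vanishes on `E` together with all its derivatives: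
`f` is holomorphic on the disk, and each derivative extends continuously to the closed
disk with the extension vanishing on `E`. -/
def VanishAllDeriv (E : Set ℂ) (f : ℂ → ℂ) : Prop :=
  ContinuousOn f (Metric.closedBall (0 : ℂ) 1) ∧
  DifferentiableOn ℂ f (Metric.ball (0 : ℂ) 1) ∧
  (∀ z ∈ E, f z = 0) ∧
  ∀ n : ℕ, ∃ g : ℂ → ℂ, ContinuousOn g (Metric.closedBall (0 : ℂ) 1) ∧
    Set.EqOn g (iteratedDeriv n f) (Metric.ball (0 : ℂ) 1) ∧ ∀ z ∈ E, g z = 0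

/-- `J₀⁺(E)`: the closure in `A⁺` of the set of elements of `A^∞(D)` vanishing on `E`
together with all their derivatives. -/
def J0Plus (E : Set ℂ) : Set (ℂ → ℂ) :=
  {f | f ∈ APlus ∧ ∀ ε > 0, ∃ g ∈ APlus, VanishAllDeriv E g ∧ APlusNorm (f - g) < ε}

/-- `I⁺(E) = {f ∈ A⁺ : f ≡ 0 on E}`. -/
def IPlus (E : Set ℂ) : Set (ℂ → ℂ) := {f ∈ APlus | ∀ z ∈ E, f z = 0}

/-- The pairing of `f ∈ A⁺ ≅ ℓ¹(ℕ)` with an element `c ∈ c₀`. -/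
def pairing (f : ℂ → ℂ) (c : ℕ → ℂ) : ℂ := ∑' n : ℕ, taylorCoeff f n * c n

/-- `S` is dense in `A⁺` for the weak-star topology `σ(ℓ¹, c₀)`. -/
def WStarDense (S : Set (ℂ → ℂ)) : Prop :=
  ∀ f ∈ APlus, ∀ (m : ℕ) (c : Fin m → ℕ → ℂ),
    (∀ i, Filter.Tendsto (c i) Filter.atTop (nhds 0)) →
    ∀ ε > 0, ∃ g ∈ S, ∀ i, ‖pairing f (c i) - pairing g (c i)‖ < ε

/-- `S` is closed in `A⁺` for the weak-star topology `σ(ℓ¹, c₀)`. -/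
def WStarClosed (S : Set (ℂ → ℂ)) : Prop :=
  S ⊆ APlus ∧
  ∀ f ∈ APlus,
    (∀ (m : ℕ) (c : Fin m → ℕ → ℂ),
      (∀ i, Filter.Tendsto (c i) Filter.atTop (nhds 0)) →
      ∀ ε > 0, ∃ g ∈ S, ∀ i, ‖pairing f (c i) - pairing g (c i)‖ < ε) → f ∈ S

/-- A Kronecker set: a compact subset of the unit circle on which every continuous
unimodular function is a uniform limit of characters `z ↦ zⁿ`, `n ∈ ℤ`. -/
def IsKronecker (K : Set ℂ) : Prop :=
  IsCompact K ∧ K ⊆ Metric.sphere (0 : ℂ) 1 ∧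
  ∀ f : ℂ → ℂ, ContinuousOn f K → (∀ z ∈ K, ‖f z‖ = 1) →
    ∀ ε > 0, ∃ n : ℤ, ∀ z ∈ K, ‖f z - z ^ n‖ < ε

/-- A Helson set: a compact subset of the unit circle on which every continuous function
is the restriction of an element of the Wiener algebra. -/
def IsHelson (K : Set ℂ) : Prop :=
  IsCompact K ∧ K ⊆ Metric.sphere (0 : ℂ) 1 ∧
  ∀ f : ℂ → ℂ, ContinuousOn f K → ∃ g ∈ WienerAlg, ∀ z ∈ K, f z = g z

/-- The little Lipschitz class `Λ_α(D)`: disc-algebra functions with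
`|f(e^{it₁}) - f(e^{it₂})| / |t₁-t₂|^α → 0` uniformly as `|t₁-t₂| → 0`. -/
def LittleLip (α : ℝ) (f : ℂ → ℂ) : Prop :=
  ContinuousOn f (Metric.closedBall (0 : ℂ) 1) ∧
  DifferentiableOn ℂ f (Metric.ball (0 : ℂ) 1) ∧
  ∀ ε > 0, ∃ δ > 0, ∀ t₁ t₂ : ℝ, t₁ ≠ t₂ → |t₁ - t₂| < δ →
    ‖f (Complex.exp ((t₁ : ℂ) * Complex.I)) - f (Complex.exp ((t₂ : ℂ) * Complex.I))‖ ≤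
      ε * |t₁ - t₂| ^ α

/-- The perfect part of a set: the union of all its perfect subsets. -/
def perfectPart (C : Set ℂ) : Set ℂ := ⋃₀ {P | Perfect P ∧ P ⊆ C}

/-- A distribution on the unit circle, encoded by its sequence of Fourier coefficients
`μ̂(n) = μ(e^{-int})`, which has polynomial growth. -/
structure CircleDistribution where
  coeff : ℤ → ℂ
  growth : ∃ (C : ℝ) (k : ℕ), ∀ n : ℤ, ‖coeff n‖ ≤ C * (1 + (n.natAbs : ℝ)) ^ k

/-- A smooth `2π`-periodic function (test function on the circle). -/
def PeriodicSmooth (φ : ℝ → ℂ) : Prop :=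
  ContDiff ℝ (⊤ : ℕ∞) φ ∧ ∀ θ : ℝ, φ (θ + 2 * Real.pi) = φ θ

/-- Fourier coefficients of a test function. -/
def testCoeff (φ : ℝ → ℂ) (n : ℤ) : ℂ :=
  (1 / (2 * Real.pi)) * ∫ θ in (0:ℝ)..(2 * Real.pi),
    φ θ * Complex.exp (-(n : ℂ) * (θ : ℂ) * Complex.I)

/-- The action of a distribution on a test function: `μ(φ) = ∑ₙ μ̂(n) φ̂(-n)`. -/
def distAct (μ : CircleDistribution) (φ : ℝ → ℂ) : ℂ := ∑' n : ℤ, μ.coeff n * testCoeff φ (-n)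

/-- The support of a distribution on the circle: the points of the circle having no open
neighbourhood `U` such that `μ` kills every test function supported in `U`. -/
def distSupport (μ : CircleDistribution) : Set ℂ :=
  {z ∈ Metric.sphere (0 : ℂ) 1 | ∀ U : Set ℂ, IsOpen U → z ∈ U →
    ∃ φ : ℝ → ℂ, PeriodicSmooth φ ∧
      (∀ θ : ℝ, Complex.exp ((θ : ℂ) * Complex.I) ∉ U → φ θ = 0) ∧ distAct μ φ ≠ 0}

/-- A set of multiplicity: a closed subset of the circle supporting a nonzero
pseudofunction (distribution whose Fourier coefficients tend to `0` as `|n| → ∞`). -/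
def IsMSet (E : Set ℂ) : Prop :=
  IsClosed E ∧ E ⊆ Metric.sphere (0 : ℂ) 1 ∧
  ∃ μ : CircleDistribution, μ.coeff ≠ 0 ∧ distSupport μ ⊆ E ∧
    Filter.Tendsto μ.coeff Filter.cofinite (nhds 0)

/-- A Dirichlet set: `sup_{z ∈ E} |z^{n_k} - 1| → 0` for some sequence `n_k → ∞`. -/
def IsDirichletSet (E : Set ℂ) : Prop :=
  ∃ n : ℕ → ℕ, Filter.Tendsto n Filter.atTop Filter.atTop ∧
    ∀ ε > 0, ∀ᶠ k in Filter.atTop, ∀ z ∈ E, ‖z ^ (n k) - 1‖ < ε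

/-- Every continuous real function on a circle is a uniform limit of real parts of entire
functions. -/
theorem exists_entire_re_approx {r : ℝ} (hr : 0 < r) {u : ℂ → ℝ}
    (hu : ContinuousOn u (sphere 0 r)) {ε : ℝ} (hε : 0 < ε) :
    ∃ p : ℂ → ℂ, Differentiable ℂ p ∧ ∀ z ∈ sphere (0 : ℂ) r, |(p z).re - u z| ≤ ε := by
  have : Fact ((0 : ℝ) < 1) := ⟨one_pos⟩
  have hrc : (r : ℂ) ≠ 0 := by exact_mod_cast hr.ne'
  have hnorm : ∀ x : AddCircle (1 : ℝ), ‖(x.toCircle : ℂ)‖ = 1 := fun x => Circle.norm_coe _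
  have hmem : ∀ x : AddCircle (1 : ℝ), (r : ℂ) * (x.toCircle : ℂ) ∈ sphere (0 : ℂ) r := by
    intro x
    rw [mem_sphere_zero_iff_norm, norm_mul, hnorm, mul_one, norm_real, Real.norm_of_nonneg hr.le]
  let U : C(AddCircle (1 : ℝ), ℂ) :=
    ⟨fun x => ((u ((r : ℂ) * (x.toCircle : ℂ)) : ℝ) : ℂ), by
      refine continuous_ofReal.comp (hu.comp_continuous ?_ hmem)
      exact continuous_const.mul (continuous_subtype_val.comp AddCircle.continuous_toCircle)⟩
  have hspan : ∀ q ∈ Submodule.span ℂ (range <| @fourier (1 : ℝ)), ∀ c : ℂ,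
      ∃ p : ℂ → ℂ, Differentiable ℂ p ∧
        ∀ x, (p ((r : ℂ) * (x.toCircle : ℂ))).re = (c * q x).re := by
    intro q hq
    induction hq using Submodule.span_induction with
    | zero => exact fun c => ⟨0, differentiable_zero, by simp⟩
    | add a b _ _ ha hb =>
      intro c
      obtain ⟨p, hp, hpa⟩ := ha c
      obtain ⟨p', hp', hpb⟩ := hb c
      refine ⟨p + p', hp.add hp', fun x => ?_⟩
      rw [Pi.add_apply, add_re, hpa, hpb, ContinuousMap.add_apply, mul_add, add_re]
    | mem q hq =>
      intro c
      obtain ⟨n, rfl⟩ := hq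
      rcases Int.eq_nat_or_neg n with ⟨m, rfl | rfl⟩
      · refine ⟨fun z => c * (z / r) ^ m, by fun_prop, fun x => ?_⟩
        beta_reduce
        rw [mul_div_cancel_left₀ _ hrc, fourier_apply, AddCircle.toCircle_zsmul]
        simp
      · refine ⟨fun z => (starRingEnd ℂ) c * (z / r) ^ m, by fun_prop, fun x => ?_⟩
        beta_reduce
        rw [mul_div_cancel_left₀ _ hrc, fourier_neg, fourier_apply, AddCircle.toCircle_zsmul,
          ← conj_re (c * _), map_mul, conj_conj]
        simp
    | smul a q hq ih =>
      intro c
      obtain ⟨p, hp, hpq⟩ := ih (c * a)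
      refine ⟨p, hp, fun x => ?_⟩
      rw [hpq, ContinuousMap.smul_apply, smul_eq_mul, mul_assoc]
  have hU : U ∈ (Submodule.span ℂ (range <| @fourier (1 : ℝ))).topologicalClosure := by
    rw [span_fourier_closure_eq_top]; trivial
  obtain ⟨q, hq, hqU⟩ := Metric.mem_closure_iff.1 hU ε hε
  obtain ⟨p, hp, hpq⟩ := hspan q hq 1
  refine ⟨p, hp, fun z hz => ?_⟩
  have hz' : ‖z‖ = r := by simpa using hz
  obtain ⟨x, hx⟩ : ∃ x : AddCircle (1 : ℝ), (r : ℂ) * (x.toCircle : ℂ) = z := by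
    let c : Circle := ⟨z / r, by simp [Submonoid.unitSphere, hz', abs_of_pos hr, hr.ne']⟩
    refine ⟨(AddCircle.homeomorphCircle one_ne_zero).symm c, ?_⟩
    rw [← AddCircle.homeomorphCircle_apply one_ne_zero, Homeomorph.apply_symm_apply]
    exact mul_div_cancel₀ _ hrc
  have h1 := ContinuousMap.dist_apply_le_dist (f := U) (g := q) x
  rw [← hx, hpq, abs_sub_comm]
  calc |u ((r : ℂ) * (x.toCircle : ℂ)) - (1 * q x).re| = |(U x - q x).re| := by simp [U]
    _ ≤ ‖U x - q x‖ := abs_re_le_norm _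
    _ ≤ ε := by rw [← dist_eq_norm]; exact h1.trans hqU.le

/-- A local form of the maximum principle coming from the Poisson formula. -/
theorem re_le_of_poissonKernel {p : ℂ → ℂ} (hp : Differentiable ℂ p) {r : ℝ} {w : ℂ}
    (hw : ‖w‖ < r) {a M : ℝ} (ha : 0 ≤ a) (hM : 0 ≤ M)
    (hlow : ∀ z ∈ sphere (0 : ℂ) r, -a ≤ (p z).re)
    (hup : ∀ z ∈ sphere (0 : ℂ) r, (p z).re ≤ a ∨ poissonKernel 0 w z ≤ M) :
    (p w).re ≤ a + M * ((p 0).re + a) := by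
  have hr : 0 < r := (norm_nonneg _).trans_lt hw
  have har : |r| = r := abs_of_pos hr
  have hw' : w ∈ ball (0 : ℂ) r := by simpa using hw
  have hd : ∀ s : Set ℂ, DiffContOnCl ℂ p s := fun s => hp.diffContOnCl
  have hP : ContinuousOn (poissonKernel 0 w) (sphere 0 r) := by
    have := continuousOn_herglotzRieszKernel_sphere hw'
    rw [har] at this
    rw [poissonKernel_eq_re_herglotzRieszKernel]
    exact continuous_re.comp_continuousOn this
  have hPnn : ∀ z ∈ sphere (0 : ℂ) r, 0 ≤ poissonKernel 0 w z := by
    intro z hz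
    have hz' : ‖z‖ = r := by simpa using hz
    simp only [poissonKernel_def, sub_zero, hz']
    apply div_nonneg _ (by positivity)
    nlinarith [norm_nonneg w]
  have key (q : ℂ → ℂ) (hq : Differentiable ℂ q) :
      Real.circleAverage (fun z => poissonKernel 0 w z * (q z).re) 0 r = (q w).re := by
    have h1 := (hq.diffContOnCl (s := ball 0 r)).circleAverage_poissonKernel_smul hw'
    rw [← h1]
    have hci : CircleIntegrable (poissonKernel 0 w • q) 0 r := by
      apply ContinuousOn.circleIntegrable hr.le
      exact hP.smul hq.continuous.continuousOn
    have := Complex.reCLM.circleAverage_comp_comm hci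
    simp only [reCLM_apply] at this
    rw [← this]
    congr 1
    ext z
    simp
  have key0 : Real.circleAverage (fun z => (p z).re) 0 r = (p 0).re := by
    have h1 := (hp.diffContOnCl (s := ball 0 |r|)).circleAverage
    rw [← h1]
    have hci : CircleIntegrable p 0 r := hp.continuous.continuousOn.circleIntegrable hr.le
    have := Complex.reCLM.circleAverage_comp_comm hci
    simp only [reCLM_apply] at this
    rw [← this]
    rfl
  have e1 := key (fun z => p z - a) (hp.sub_const _)
  have e2 : Real.circleAverage (fun z => M * (p z).re + M * a) 0 r = M * (p 0).re + M * a := by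
    rw [Real.circleAverage_fun_add, Real.circleAverage_const, ← key0]
    · congr 1
      exact Real.circleAverage_fun_smul (a := M) (f := fun z => (p z).re)
    · apply ContinuousOn.circleIntegrable hr.le
      exact (continuous_const.mul (continuous_re.comp hp.continuous)).continuousOn
    · exact continuousOn_const.circleIntegrable hr.le
  have hmono := Real.circleAverage_mono
    (f₁ := fun z => poissonKernel 0 w z * (p z - a).re)
    (f₂ := fun z => M * (p z).re + M * a) (c := 0) (R := r) ?_ ?_ ?_
  · rw [e1, e2] at hmono
    simp only [sub_re, ofReal_re] at hmono
    linarith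
  · apply ContinuousOn.circleIntegrable hr.le
    exact hP.mul (continuous_re.comp (hp.sub_const _).continuous).continuousOn
  · apply ContinuousOn.circleIntegrable hr.le
    exact ((continuous_const.mul (continuous_re.comp hp.continuous)).add
      continuous_const).continuousOn
  · intro z hz
    rw [har] at hz
    have h1 := hlow z hz
    have h2 := hPnn z hz
    simp only [sub_re, ofReal_re]
    rcases hup z hz with h | h
    · nlinarith [mul_nonneg h2 (sub_nonneg.2 h), mul_nonneg hM (by linarith : 0 ≤ (p z).re + a)]
    · nlinarith [mul_nonneg (sub_nonneg.2 h) (by linarith : 0 ≤ (p z).re + a), mul_nonneg h2 ha]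

/-- Harnack's inequality. -/
theorem re_le_harnack {p : ℂ → ℂ} (hp : Differentiable ℂ p) {r : ℝ} {w : ℂ}
    (hw : ‖w‖ < r) {a : ℝ} (ha : 0 ≤ a)
    (hlow : ∀ z ∈ sphere (0 : ℂ) r, -a ≤ (p z).re) :
    (p w).re ≤ a + (r + ‖w‖) / (r - ‖w‖) * ((p 0).re + a) := by
  have hr : 0 < r := (norm_nonneg _).trans_lt hw
  refine re_le_of_poissonKernel hp hw ha
    (div_nonneg (by positivity) (by linarith)) hlow fun z hz => Or.inr ?_
  rw [poissonKernel_eq_re_herglotzRieszKernel]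
  have := re_herglotzRieszKernel_le hz (w := w) (by simpa using hw)
  simpa [herglotzRieszKernel_def] using this

section PowerBounded

variable {B : Type*} [NormedRing B] [NormedAlgebra ℂ B] {T : B}

theorem resolvent_mul_sub {l : ℂ} (hl : l ∈ resolventSet ℂ T) :
    resolvent T l * (algebraMap ℂ B l - T) = 1 :=
  Ring.inverse_mul_cancel _ hl

theorem sub_mul_resolvent {l : ℂ} (hl : l ∈ resolventSet ℂ T) :
    (algebraMap ℂ B l - T) * resolvent T l = 1 :=
  Ring.mul_inverse_cancel _ hl

variable [CompleteSpace B]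

theorem summable_smul_pow (hT : ∀ n, ‖T ^ n‖ ≤ 1) {a : ℕ → ℂ} (ha : Summable fun n => ‖a n‖) :
    Summable fun n => a n • T ^ n := by
  refine Summable.of_norm_bounded ha fun n => ?_
  rw [norm_smul]
  exact mul_le_of_le_one_right (norm_nonneg _) (hT n)

theorem mem_resolventSet_of_one_lt (hT : ∀ n, ‖T ^ n‖ ≤ 1) {l : ℂ} (hl : 1 < ‖l‖) :
    l ∈ resolventSet ℂ T := by
  apply spectrum.mem_resolventSet_of_norm_lt_mul
  have h0 := hT 0
  have h1 := hT 1
  rw [pow_zero] at h0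
  rw [pow_one] at h1
  nlinarith [norm_nonneg T, norm_nonneg (1 : B)]

theorem norm_resolvent_le_of_one_lt (hT : ∀ n, ‖T ^ n‖ ≤ 1) {l : ℂ} (hl : 1 < ‖l‖) :
    ‖resolvent T l‖ ≤ 1 / (‖l‖ - 1) := by
  have h := sub_mul_resolvent (mem_resolventSet_of_one_lt hT hl)
  have h0 := hT 0
  have h1 := hT 1
  rw [pow_zero] at h0
  rw [pow_one] at h1
  rw [le_div_iff₀ (by linarith)]
  have e : l • resolvent T l = 1 + T * resolvent T l := by
    rw [← h, sub_mul, Algebra.smul_def]; abel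
  have := norm_add_le (1 : B) (T * resolvent T l)
  rw [← e, norm_smul] at this
  have h2 := norm_mul_le T (resolvent T l)
  nlinarith [norm_nonneg (resolvent T l)]

theorem hasSum_resolvent (hT : ∀ n, ‖T ^ n‖ ≤ 1) {l : ℂ} (hl : 1 < ‖l‖) :
    HasSum (fun n : ℕ => (l ^ (n + 1))⁻¹ • T ^ n) (resolvent T l) := by
  have hl0 : l ≠ 0 := by rintro rfl; simp at hl; linarith
  have hs : Summable fun n : ℕ => (l ^ (n + 1))⁻¹ • T ^ n := by
    apply summable_smul_pow hT
    simp only [norm_inv, norm_pow]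
    have : ∀ n : ℕ, (‖l‖ ^ (n + 1))⁻¹ = (‖l‖⁻¹) ^ n * ‖l‖⁻¹ := fun n => by
      rw [← inv_pow, pow_succ]
    simp only [this]
    exact (summable_geometric_of_lt_one (by positivity) (inv_lt_one_of_one_lt₀ hl)).mul_right _
  have key : (algebraMap ℂ B l - T) * ∑' n : ℕ, (l ^ (n + 1))⁻¹ • T ^ n = 1 := by
    have e1 : (algebraMap ℂ B l) * ∑' n : ℕ, (l ^ (n + 1))⁻¹ • T ^ n
        = ∑' n : ℕ, (l ^ n)⁻¹ • T ^ n := by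
      rw [← hs.tsum_mul_left]
      congr 1; ext n
      rw [← Algebra.smul_def, smul_smul, pow_succ, mul_inv, mul_comm, mul_assoc,
        inv_mul_cancel₀ hl0, mul_one]
    have e2 : T * ∑' n : ℕ, (l ^ (n + 1))⁻¹ • T ^ n
        = ∑' n : ℕ, (l ^ (n + 1))⁻¹ • T ^ (n + 1) := by
      rw [← hs.tsum_mul_left]
      congr 1; ext n
      rw [mul_smul_comm, ← pow_succ']
    have hs' : Summable fun n : ℕ => (l ^ n)⁻¹ • T ^ n := by
      refine (hs.mul_left (algebraMap ℂ B l)).congr fun n => ?_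
      rw [← Algebra.smul_def, smul_smul, pow_succ, mul_inv, mul_comm, mul_assoc,
        inv_mul_cancel₀ hl0, mul_one]
    rw [sub_mul, e1, e2, hs'.tsum_eq_zero_add]
    simp
  have : resolvent T l = ∑' n : ℕ, (l ^ (n + 1))⁻¹ • T ^ n := by
    rw [← one_mul (∑' n : ℕ, (l ^ (n + 1))⁻¹ • T ^ n),
      ← resolvent_mul_sub (mem_resolventSet_of_one_lt hT hl), mul_assoc, key, mul_one]
  rw [this]
  exact hs.hasSum

theorem mem_resolventSet_of_tsum_ne_zero (hT : ∀ n, ‖T ^ n‖ ≤ 1) {a : ℕ → ℂ}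
    (ha : Summable fun n => ‖a n‖) (haT : ∑' n, a n • T ^ n = 0) {l : ℂ} (hl : ‖l‖ ≤ 1)
    (hne : ∑' n, a n * l ^ n ≠ 0) : l ∈ resolventSet ℂ T := by
  by_contra hcon
  have hmem : l ∈ spectrum ℂ T := hcon
  apply hne
  have hs : Summable fun n => a n * l ^ n := by
    refine Summable.of_norm_bounded ha fun n => ?_
    rw [norm_mul, norm_pow]
    exact mul_le_of_le_one_right (norm_nonneg _) (pow_le_one₀ (norm_nonneg _) hl)
  have h1 := hs.hasSum.tendsto_sum_nat.norm
  have h2 := (summable_smul_pow hT ha).hasSum.tendsto_sum_nat.norm.mul_const ‖(1 : B)‖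
  rw [haT, norm_zero, zero_mul] at h2
  have := le_of_tendsto_of_tendsto' h1 h2 fun N => ?_
  · exact norm_le_zero_iff.1 this
  let P : Polynomial ℂ := ∑ n ∈ Finset.range N, Polynomial.C (a n) * Polynomial.X ^ n
  have h3 := spectrum.subset_polynomial_aeval T P ⟨l, hmem, rfl⟩
  have h4 := spectrum.norm_le_norm_mul_of_mem h3
  simpa [P, Polynomial.eval_finsetSum, Algebra.smul_def] using h4

theorem norm_tsum_smul_resolvent_le (hT : ∀ n, ‖T ^ n‖ ≤ 1) {a : ℕ → ℂ}
    (ha : Summable fun n => ‖a n‖) (haT : ∑' n, a n • T ^ n = 0) {l : ℂ} (hl : ‖l‖ < 1)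
    (hr : l ∈ resolventSet ℂ T) :
    ‖(∑' n, a n * l ^ n) • resolvent T l‖ ≤ (∑' n, ‖a n‖) / (1 - ‖l‖) := by
  have hs : Summable fun n => a n * l ^ n := by
    refine Summable.of_norm_bounded ha fun n => ?_
    rw [norm_mul, norm_pow]
    exact mul_le_of_le_one_right (norm_nonneg _) (pow_le_one₀ (norm_nonneg _) hl.le)
  have h1 : HasSum (fun n => a n • ((l ^ n) • resolvent T l - resolvent T l * T ^ n))
      ((∑' n, a n * l ^ n) • resolvent T l) := by
    have e1 := hs.hasSum.smul_const (resolvent T l)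
    have e2 := ((summable_smul_pow hT ha).hasSum).mul_left (resolvent T l)
    rw [haT, mul_zero] at e2
    have e3 := e1.sub e2
    rw [sub_zero] at e3
    refine e3.congr_fun fun n => ?_
    rw [smul_sub, smul_smul, mul_smul_comm]
  have h2 : ∀ n, ‖a n • ((l ^ n) • resolvent T l - resolvent T l * T ^ n)‖
      ≤ ‖a n‖ * (1 - ‖l‖)⁻¹ := by
    intro n
    rw [norm_smul]
    gcongr
    have hc : Commute (algebraMap ℂ B l) T := Algebra.commutes l T
    have e := hc.mul_geom_sum₂ n
    have e3 : (l ^ n) • resolvent T l - resolvent T l * T ^ n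
        = ∑ i ∈ Finset.range n, algebraMap ℂ B l ^ i * T ^ (n - 1 - i) := by
      rw [← one_mul (∑ i ∈ Finset.range n, _), ← resolvent_mul_sub hr, mul_assoc, e, mul_sub,
        Algebra.smul_def, ← map_pow, Algebra.commutes]
    rw [e3]
    calc _ ≤ ∑ i ∈ Finset.range n, ‖l‖ ^ i := by
          refine norm_sum_le_of_le _ fun i _ => ?_
          rw [← map_pow, ← Algebra.smul_def, norm_smul, norm_pow]
          exact mul_le_of_le_one_right (by positivity) (hT _)
      _ ≤ ∑' i : ℕ, ‖l‖ ^ i := (summable_geometric_of_lt_one (norm_nonneg _) hl).sum_le_tsum _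
          fun i _ => by positivity
      _ = _ := tsum_geometric_of_lt_one (norm_nonneg _) hl
  have h3 := h1.norm_le_of_bounded (ha.mul_right ((1 - ‖l‖)⁻¹)).hasSum h2
  rwa [tsum_mul_right, ← div_eq_mul_inv] at h3

theorem differentiableOn_resolvent : DifferentiableOn ℂ (resolvent T) (resolventSet ℂ T) :=
  fun _ hz => (spectrum.hasDerivAt_resolvent_const_left hz).differentiableAt.differentiableWithinAt

end PowerBounded

theorem commute_tsum_smul_pow {B : Type*} [NormedRing B] [NormedAlgebra ℂ B] (T : B)
    (a : ℕ → ℂ) : Commute (∑' n, a n • T ^ n) T :=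
  Commute.tsum_left _ fun n => ((Commute.refl T).pow_left n).smul_left (a n)

section Shift

open scoped ENNReal

/-- The norm on `ℓ¹`. -/
theorem lp_one_norm_eq (a : lp (fun _ : ℕ => ℂ) 1) : ‖a‖ = ∑' n, ‖a n‖ := by
  rw [lp.norm_eq_tsum_rpow (by simp)]
  simp

theorem lp_one_summable (a : lp (fun _ : ℕ => ℂ) 1) : Summable fun n => ‖a n‖ := by
  have := (memℓp_gen_iff (p := 1) (by simp)).1 (lp.memℓp a)
  simpa using this

theorem memlp_one {a : ℕ → ℂ} (ha : Summable fun n => ‖a n‖) :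
    Memℓp (E := fun _ => ℂ) a 1 :=
  (memℓp_gen_iff (by simp)).2 (by simpa using ha)

/-- The unilateral shift of a sequence. -/
def seqShift (a : ℕ → ℂ) : ℕ → ℂ
  | 0 => 0
  | n + 1 => a n

theorem summable_seqShift {a : ℕ → ℂ} (ha : Summable fun n => ‖a n‖) :
    Summable fun n => ‖seqShift a n‖ :=
  (summable_nat_add_iff 1).1 ha

/-- The unilateral shift on `ℓ¹`. -/
def lpShift : lp (fun _ : ℕ => ℂ) 1 →L[ℂ] lp (fun _ : ℕ => ℂ) 1 :=
  LinearMap.mkContinuous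
    { toFun := fun a => ⟨seqShift a, memlp_one (summable_seqShift (lp_one_summable a))⟩
      map_add' := fun a b => by
        ext n
        cases n
        · exact (add_zero (0 : ℂ)).symm
        · rfl
      map_smul' := fun c a => by
        ext n; cases n <;> simp [seqShift] } 1 fun a => by
    rw [one_mul, lp_one_norm_eq, lp_one_norm_eq,
      (lp_one_summable _).tsum_eq_zero_add]
    simp [seqShift]

theorem lpShift_apply (a : lp (fun _ : ℕ => ℂ) 1) (n : ℕ) : lpShift a n = seqShift a n := rfl

theorem lpShift_norm_le (a : lp (fun _ : ℕ => ℂ) 1) : ‖lpShift a‖ ≤ ‖a‖ := by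
  refine (lpShift.le_opNorm a).trans (mul_le_of_le_one_left (norm_nonneg _) ?_)
  exact LinearMap.mkContinuous_norm_le _ zero_le_one _

theorem lpShift_single (n : ℕ) (c : ℂ) :
    lpShift (lp.single 1 n c) = lp.single 1 (n + 1) c := by
  ext k
  rw [lpShift_apply]
  rcases k with _ | k
  · simp [seqShift]
  · simp [seqShift, Pi.single_apply]

/-- The shift acts as a power-bounded operator on the quotient of `ℓ¹` by a closed
shift-invariant subspace. -/
theorem exists_quotient_shift (N : Submodule ℂ (lp (fun _ : ℕ => ℂ) 1))
    (hN : IsClosed (N : Set (lp (fun _ : ℕ => ℂ) 1))) (hS : ∀ a ∈ N, lpShift a ∈ N) :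
    ∃ (B : Type) (_ : NormedRing B) (_ : NormedAlgebra ℂ B) (_ : CompleteSpace B)
      (T : B), (∀ n, ‖T ^ n‖ ≤ 1) ∧
        ∀ a : lp (fun _ : ℕ => ℂ) 1, ∑' n, a n • T ^ n = 0 ↔ a ∈ N := by
  have := hN
  let T : (lp (fun _ : ℕ => ℂ) 1 ⧸ N) →L[ℂ] (lp (fun _ : ℕ => ℂ) 1 ⧸ N) :=
    N.liftQL (N.mkQL ∘L lpShift) fun a ha => by
      simpa [Submodule.Quotient.mk_eq_zero] using hS a ha
  have hTmk : ∀ a, T (N.mkQL a) = N.mkQL (lpShift a) := fun a => by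
    simp [T]
  have hle : ∀ x, ‖T x‖ ≤ ‖x‖ := by
    intro x
    refine le_of_forall_pos_lt_add fun ε hε => ?_
    obtain ⟨m, rfl, hm⟩ := Submodule.Quotient.norm_mk_lt x hε
    have h1 := hTmk m
    have h2 : ‖N.mkQL (lpShift m)‖ ≤ ‖lpShift m‖ := Submodule.Quotient.norm_mk_le N _
    have h3 := lpShift_norm_le m
    calc _ = ‖N.mkQL (lpShift m)‖ := by rw [← h1]; rfl
      _ < _ := (h2.trans h3).trans_lt hm
  have hT : ∀ n, ‖T ^ n‖ ≤ 1 := by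
    intro n
    refine ContinuousLinearMap.opNorm_le_bound _ zero_le_one fun x => ?_
    rw [one_mul]
    induction n with
    | zero => simp
    | succ n ih => rw [pow_succ']; exact (hle _).trans ih
  have hpow : ∀ k, (T ^ k) (N.mkQL (lp.single 1 0 1)) = N.mkQL (lp.single 1 k 1) := by
    intro k
    induction k with
    | zero => simp
    | succ k ih =>
      rw [pow_succ', mul_apply_eq_comp, ih, hTmk, lpShift_single]
  refine ⟨(lp (fun _ : ℕ => ℂ) 1 ⧸ N) →L[ℂ] (lp (fun _ : ℕ => ℂ) 1 ⧸ N), inferInstance,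
    inferInstance, inferInstance, T, hT, fun a => ?_⟩
  have hs := summable_smul_pow
    (B := (lp (fun _ : ℕ => ℂ) 1 ⧸ N) →L[ℂ] (lp (fun _ : ℕ => ℂ) 1 ⧸ N)) hT (lp_one_summable a)
  set F := ∑' n, a n • T ^ n with hF
  have hF0 : F (N.mkQL (lp.single 1 0 1)) = N.mkQL a := by
    have h1 := (hs.hasSum).mapL (ContinuousLinearMap.apply ℂ _ (N.mkQL (lp.single 1 0 1)))
    have h2 := (lp.hasSum_single (p := 1) (by simp) a).mapL N.mkQL
    refine h1.unique (h2.congr_fun fun n => ?_)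
    simp only [ContinuousLinearMap.apply_apply, smul_apply, hpow]
    rw [← map_smul, ← lp.single_smul, smul_eq_mul, mul_one]
  have hmem : a ∈ N ↔ N.mkQL a = 0 := by
    simp [Submodule.Quotient.mk_eq_zero]
  rw [hmem, ← hF0]
  refine ⟨fun h => by rw [h]; rfl, fun h => ?_⟩
  have hcomm : Commute F T := commute_tsum_smul_pow
    (B := (lp (fun _ : ℕ => ℂ) 1 ⧸ N) →L[ℂ] (lp (fun _ : ℕ => ℂ) 1 ⧸ N)) T a
  have hk : ∀ k, F (N.mkQL (lp.single 1 k 1)) = 0 := by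
    intro k
    rw [← hpow, ← mul_apply_eq_comp, (hcomm.pow_right k).eq,
      mul_apply_eq_comp, h, map_zero]
  ext x
  obtain ⟨b, rfl⟩ := Submodule.Quotient.mk_surjective N x
  have h2 := (lp.hasSum_single (p := 1) (by simp) b).mapL (F ∘L N.mkQL)
  have h3 : ∀ n, (F ∘L N.mkQL) (lp.single 1 n (b n)) = 0 := by
    intro n
    have : lp.single (E := fun _ : ℕ => ℂ) 1 n (b n) = b n • lp.single 1 n 1 := by
      rw [← lp.single_smul, smul_eq_mul, mul_one]
    rw [this, map_smul, ContinuousLinearMap.comp_apply, hk, smul_zero]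
  simp only [h3] at h2
  exact h2.unique hasSum_zero

end Shift

/-- `a` is an absolutely summable sequence of Taylor coefficients of `f` on the closed disk. -/
def IsAPlusCoeff (f : ℂ → ℂ) (a : ℕ → ℂ) : Prop :=
  Summable (fun n => ‖a n‖) ∧
    ∀ z ∈ Metric.closedBall (0 : ℂ) 1, HasSum (fun n => a n * z ^ n) (f z)

theorem IsAPlusCoeff.taylorCoeff_eq {f : ℂ → ℂ} {a : ℕ → ℂ} (h : IsAPlusCoeff f a) (n : ℕ) :
    taylorCoeff f n = a n := by
  have hf : HasFPowerSeriesOnBall f (FormalMultilinearSeries.ofScalars ℂ a) 0 1 := by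
    refine ⟨?_, one_pos, ?_⟩
    · refine FormalMultilinearSeries.le_radius_of_summable_norm _ ?_
      refine Summable.of_norm_bounded h.1 fun n => ?_
      simp
    · intro y hy
      have hy' : y ∈ closedBall (0 : ℂ) 1 := by
        rw [← ENNReal.ofReal_one, Metric.eball_ofReal] at hy
        exact ball_subset_closedBall hy
      have := h.2 y hy'
      rw [zero_add]
      refine this.congr_fun fun n => ?_
      simp [mul_comm]
  have h2 := hf.analyticAt.hasFPowerSeriesAt
  have h3 := h2.eq_formalMultilinearSeries hf.hasFPowerSeriesAt
  have h4 := congrArg (fun p => p.coeff n) h3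
  simpa [FormalMultilinearSeries.coeff_ofScalars, taylorCoeff] using h4

theorem IsAPlusCoeff.norm_eq {f : ℂ → ℂ} {a : ℕ → ℂ} (h : IsAPlusCoeff f a) :
    APlusNorm f = ∑' n, ‖a n‖ := by
  simp only [APlusNorm, h.taylorCoeff_eq]

theorem IsAPlusCoeff.add {f g : ℂ → ℂ} {a b : ℕ → ℂ} (hf : IsAPlusCoeff f a)
    (hg : IsAPlusCoeff g b) : IsAPlusCoeff (f + g) (a + b) := by
  refine ⟨?_, fun z hz => ?_⟩
  · exact Summable.of_nonneg_of_le (fun _ => norm_nonneg _) (fun n => norm_add_le _ _)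
      (hf.1.add hg.1)
  · refine ((hf.2 z hz).add (hg.2 z hz)).congr_fun fun n => ?_
    simp [add_mul]

theorem IsAPlusCoeff.sub {f g : ℂ → ℂ} {a b : ℕ → ℂ} (hf : IsAPlusCoeff f a)
    (hg : IsAPlusCoeff g b) : IsAPlusCoeff (f - g) (a - b) := by
  refine ⟨?_, fun z hz => ?_⟩
  · exact Summable.of_nonneg_of_le (fun _ => norm_nonneg _) (fun n => norm_sub_le _ _)
      (hf.1.add hg.1)
  · refine ((hf.2 z hz).sub (hg.2 z hz)).congr_fun fun n => ?_
    simp [sub_mul]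

theorem IsAPlusCoeff.const_mul {f : ℂ → ℂ} {a : ℕ → ℂ} (hf : IsAPlusCoeff f a) (c : ℂ) :
    IsAPlusCoeff ((fun _ => c) * f) (c • a) := by
  refine ⟨?_, fun z hz => ?_⟩
  · simpa using hf.1.mul_left ‖c‖
  · refine ((hf.2 z hz).mul_left c).congr_fun fun n => ?_
    simp [mul_assoc]

theorem IsAPlusCoeff.shift {f : ℂ → ℂ} {a : ℕ → ℂ} (hf : IsAPlusCoeff f a) :
    IsAPlusCoeff ((fun z => z) * f) (seqShift a) := by
  refine ⟨summable_seqShift hf.1, fun z hz => ?_⟩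
  rw [← hasSum_nat_add_iff' 1]
  refine HasSum.congr_fun (f := fun n => z * (a n * z ^ n)) ?_ fun n => ?_
  · simpa [seqShift] using (hf.2 z hz).mul_left z
  · simp only [seqShift]; ring

theorem isAPlusCoeff_one : IsAPlusCoeff (fun _ => 1) (Pi.single 0 1) := by
  have h : ∀ n, n ≠ 0 → (Pi.single 0 1 : ℕ → ℂ) n = 0 := fun n hn => by simp [hn]
  refine ⟨summable_of_ne_finset_zero (s := {0}) fun n hn => by
    simp at hn; simp [hn], fun z _ => ?_⟩
  have := hasSum_single (f := fun n => (Pi.single 0 1 : ℕ → ℂ) n * z ^ n) 0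
    fun n hn => by simp [hn]
  simpa using this

theorem const_mem_APlus (c : ℂ) : (fun _ => c) ∈ APlus := by
  have h := isAPlusCoeff_one.const_mul c
  refine ⟨_, h.1, fun z hz => ?_⟩
  simpa using h.2 z hz

theorem id_mem_APlus : (fun z => z) ∈ APlus := by
  have h := isAPlusCoeff_one.shift
  refine ⟨_, h.1, fun z hz => ?_⟩
  simpa using h.2 z hz

/-- The sum of a power series on the closed disk, extended by zero. -/
def diskSum (a : ℕ → ℂ) (z : ℂ) : ℂ :=
  open Classical in if ‖z‖ ≤ 1 then ∑' n, a n * z ^ n else 0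

theorem isAPlusCoeff_diskSum {a : ℕ → ℂ} (ha : Summable fun n => ‖a n‖) :
    IsAPlusCoeff (diskSum a) a := by
  refine ⟨ha, fun z hz => ?_⟩
  rw [mem_closedBall_zero_iff] at hz
  rw [diskSum, if_pos hz]
  refine (Summable.of_norm_bounded ha fun n => ?_).hasSum
  rw [norm_mul, norm_pow]
  exact mul_le_of_le_one_right (norm_nonneg _) (pow_le_one₀ (norm_nonneg _) hz)

theorem IsAPlusCoeff.eq_diskSum {f : ℂ → ℂ} {a : ℕ → ℂ} (hf : IsAPlusCoeff f a)
    (h0 : ∀ z, ¬ ‖z‖ ≤ 1 → f z = 0) : f = diskSum a := by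
  ext z
  by_cases hz : ‖z‖ ≤ 1
  · have hz' : z ∈ closedBall (0 : ℂ) 1 := by simpa using hz
    exact (hf.2 z hz').unique ((isAPlusCoeff_diskSum hf.1).2 z hz')
  · rw [h0 z hz, diskSum, if_neg hz]

theorem diskSum_of_not {a : ℕ → ℂ} {z : ℂ} (hz : ¬ ‖z‖ ≤ 1) : diskSum a z = 0 := if_neg hz

theorem IsClosedIdealAPlus.mem_of_coeff {I : Set (ℂ → ℂ)} (hI : IsClosedIdealAPlus I)
    {f g : ℂ → ℂ} {a : ℕ → ℂ} (hf : IsAPlusCoeff f a) (hg : IsAPlusCoeff g a) (hgI : g ∈ I) :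
    f ∈ I := by
  refine hI.2.2.2 f ⟨a, hf⟩ fun ε hε => ⟨g, hgI, ?_⟩
  rw [(hf.sub hg).norm_eq]
  simpa using hε

/-- A closed ideal of `A⁺` is the kernel of the functional calculus of a power-bounded element
of a Banach algebra. -/
theorem IsClosedIdealAPlus.exists_model {I : Set (ℂ → ℂ)} (hI : IsClosedIdealAPlus I)
    (hne : I.Nonempty) :
    ∃ (B : Type) (_ : NormedRing B) (_ : NormedAlgebra ℂ B) (_ : CompleteSpace B)
      (T : B), (∀ n, ‖T ^ n‖ ≤ 1) ∧
        ∀ f a, IsAPlusCoeff f a → (∑' n, a n • T ^ n = 0 ↔ f ∈ I) := by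
  let N : Submodule ℂ (lp (fun _ : ℕ => ℂ) 1) :=
    { carrier := {a | diskSum a ∈ I}
      add_mem' := by
        intro a b ha hb
        have := (isAPlusCoeff_diskSum (lp_one_summable a)).add
          (isAPlusCoeff_diskSum (lp_one_summable b))
        have h2 := this.eq_diskSum fun z hz => by simp [diskSum_of_not hz]
        have h3 := hI.2.1 _ ha _ hb
        rw [h2] at h3
        exact h3
      zero_mem' := by
        obtain ⟨f, hf⟩ := hne
        obtain ⟨a, ha⟩ := hI.1 hf
        have h1 := hI.2.2.1 _ (const_mem_APlus 0) f hf
        have h2 := IsAPlusCoeff.const_mul ha 0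
        rw [zero_smul] at h2
        exact hI.mem_of_coeff (isAPlusCoeff_diskSum h2.1) h2 h1
      smul_mem' := by
        intro c a ha
        have := (isAPlusCoeff_diskSum (lp_one_summable a)).const_mul c
        have h2 := this.eq_diskSum fun z hz => by simp [diskSum_of_not hz]
        have h3 := hI.2.2.1 _ (const_mem_APlus c) _ ha
        rw [h2] at h3
        exact h3 }
  have hNmem : ∀ a, a ∈ N ↔ diskSum a ∈ I := fun a => Iff.rfl
  have hN : IsClosed (N : Set (lp (fun _ : ℕ => ℂ) 1)) := by
    refine isClosed_of_closure_subset fun a ha => ?_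
    refine hI.2.2.2 _ ⟨_, isAPlusCoeff_diskSum (lp_one_summable a)⟩ fun ε hε => ?_
    obtain ⟨b, hb, hab⟩ := Metric.mem_closure_iff.1 ha ε hε
    refine ⟨_, hb, ?_⟩
    have := (isAPlusCoeff_diskSum (lp_one_summable a)).sub
          (isAPlusCoeff_diskSum (lp_one_summable b))
    rw [this.norm_eq]
    rw [dist_eq_norm, lp_one_norm_eq] at hab
    exact hab
  have hS : ∀ a ∈ N, lpShift a ∈ N := by
    intro a ha
    have := (isAPlusCoeff_diskSum (lp_one_summable a)).shift
    have h2 := this.eq_diskSum fun z hz => by simp [diskSum_of_not hz]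
    have h3 := hI.2.2.1 _ id_mem_APlus _ ha
    rw [h2] at h3
    exact h3
  obtain ⟨B, i1, i2, i3, T, hT, h⟩ := exists_quotient_shift N hN hS
  refine ⟨B, i1, i2, i3, T, hT, fun f a ha => ?_⟩
  have h1 := h ⟨a, memlp_one ha.1⟩
  rw [hNmem] at h1
  refine h1.trans ⟨fun h => hI.mem_of_coeff ha (isAPlusCoeff_diskSum ha.1) h,
    fun h => hI.mem_of_coeff (isAPlusCoeff_diskSum ha.1) ha h⟩

/-- Maximum principle on a disk. -/
theorem norm_le_of_sphere_le {V : Type*} [NormedAddCommGroup V] [NormedSpace ℂ V] {F : ℂ → V}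
    {c : ℂ} {r M : ℝ} (hF : DifferentiableOn ℂ F (closedBall c r)) (hr : 0 < r)
    (hM : ∀ z ∈ sphere c r, ‖F z‖ ≤ M) {z : ℂ} (hz : z ∈ closedBall c r) : ‖F z‖ ≤ M := by
  rw [← closure_ball c hr.ne'] at hz
  refine Complex.norm_le_of_forall_mem_frontier_norm_le isBounded_ball
    (DifferentiableOn.diffContOnCl ?_) (fun w hw => ?_) hz
  · rwa [closure_ball c hr.ne']
  · rw [frontier_ball c hr.ne'] at hw
    exact hM w hw

theorem exp_log_max_one (x : ℝ) : Real.exp (Real.log (max 1 x)) = max 1 x :=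
  Real.exp_log (lt_max_of_lt_left one_pos)

/-- An entire function whose real part is close to `log⁺ ‖R‖` on a circle. -/
theorem exists_entire_re_approx_log {V : Type*} [NormedAddCommGroup V] {R : ℂ → V} {r : ℝ}
    (hr : 0 < r) (hR : ContinuousOn R (sphere 0 r)) {ε : ℝ} (hε : 0 < ε) :
    ∃ p : ℂ → ℂ, Differentiable ℂ p ∧ ∀ z ∈ sphere (0 : ℂ) r,
      -ε ≤ (p z).re ∧ Real.exp (p z).re ≤ Real.exp ε * max 1 ‖R z‖ ∧
      max 1 ‖R z‖ ≤ Real.exp ε * Real.exp (p z).re := by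
  have hu : ContinuousOn (fun z => Real.log (max 1 ‖R z‖)) (sphere 0 r) := by
    refine ContinuousOn.log (continuousOn_const.sup hR.norm) fun z _ => ?_
    exact (lt_max_of_lt_left one_pos).ne'
  obtain ⟨p, hp, hpu⟩ := exists_entire_re_approx hr hu hε
  refine ⟨p, hp, fun z hz => ?_⟩
  have h1 := abs_le.1 (hpu z hz)
  have h2 : 0 ≤ Real.log (max 1 ‖R z‖) := Real.log_nonneg (le_max_left _ _)
  refine ⟨by linarith [h1.1], ?_, ?_⟩
  · rw [← exp_log_max_one ‖R z‖, ← Real.exp_add]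
    exact Real.exp_le_exp.2 (by linarith [h1.2])
  · conv_lhs => rw [← exp_log_max_one ‖R z‖]
    rw [← Real.exp_add]
    exact Real.exp_le_exp.2 (by linarith [h1.1])

theorem exists_norm_le_exp {V : Type*} [NormedAddCommGroup V] [NormedSpace ℂ V]
    {R : ℂ → V} (hR : DifferentiableOn ℂ R (ball 0 1)) {f : ℂ → ℂ} {K : ℝ}
    (hf : DifferentiableOn ℂ f (ball 0 1)) (hfK : ∀ z ∈ ball (0 : ℂ) 1, ‖f z‖ ≤ K)
    (hfR : ∀ z ∈ ball (0 : ℂ) 1, ‖f z • R z‖ ≤ K / (1 - ‖z‖)) (hf0 : f 0 ≠ 0) :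
    ∃ C : ℝ, ∀ z ∈ ball (0 : ℂ) 1, ‖R z‖ ≤ Real.exp (C / (1 - ‖z‖) ^ 2) := by
  have hf0' : 0 < ‖f 0‖ := norm_pos_iff.2 hf0
  have hK : ‖f 0‖ ≤ K := hfK 0 (by simp)
  have hKpos : 0 < K := hf0'.trans_le hK
  set L := Real.log (K / ‖f 0‖) with hL
  have hLnn : 0 ≤ L := Real.log_nonneg ((one_le_div hf0').2 hK)
  refine ⟨18 + 4 * L, fun z hz => ?_⟩
  have hz1 : ‖z‖ < 1 := by simpa using hz
  have hznn := norm_nonneg z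
  set s := 1 - ‖z‖ with hs
  have hs0 : 0 < s := by linarith
  set r := (1 + ‖z‖) / 2 with hr
  have hr0 : 0 < r := by linarith
  have hr1 : r < 1 := by linarith
  have hsub : closedBall (0 : ℂ) r ⊆ ball 0 1 := closedBall_subset_ball hr1
  have hRr := hR.mono hsub
  obtain ⟨p, hp, hpr⟩ := exists_entire_re_approx_log hr0
    (hRr.continuousOn.mono sphere_subset_closedBall) one_pos
  have b1 : ‖exp (-p z) • R z‖ ≤ Real.exp 1 := by
    refine norm_le_of_sphere_le (F := fun z => exp (-p z) • R z) (c := 0)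
      (hp.neg.cexp.differentiableOn.smul hRr) hr0 (fun w hw => ?_)
      (by rw [mem_closedBall_zero_iff]; linarith)
    rw [norm_smul, norm_exp, neg_re]
    have h1 := (hpr w hw).2.2
    have h2 : ‖R w‖ ≤ Real.exp 1 * Real.exp (p w).re := (le_max_right _ _).trans h1
    calc _ ≤ Real.exp (-(p w).re) * (Real.exp 1 * Real.exp (p w).re) := by gcongr
      _ = Real.exp 1 := by
        rw [mul_left_comm, ← Real.exp_add]; simp
  have b2 : ‖f 0 * exp (p 0)‖ ≤ Real.exp 1 * (K / (1 - r)) := by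
    refine norm_le_of_sphere_le (F := fun z => f z * exp (p z)) (c := 0)
      ((hf.mono hsub).mul hp.cexp.differentiableOn) hr0 (fun w hw => ?_) (by simpa using hr0.le)
    rw [norm_mul, norm_exp]
    have h1 := (hpr w hw).2.1
    have hw' : ‖w‖ = r := by simpa using hw
    have hwb : w ∈ ball (0 : ℂ) 1 := hsub (sphere_subset_closedBall hw)
    have h3 : ‖f w‖ * max 1 ‖R w‖ ≤ K / (1 - r) := by
      rw [mul_max_of_nonneg _ _ (norm_nonneg _), mul_one, ← norm_smul]
      refine max_le ((hfK w hwb).trans ?_) ?_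
      · rw [le_div_iff₀ (by linarith)]
        nlinarith
      · have := hfR w hwb
        rwa [hw'] at this
    calc _ ≤ ‖f w‖ * (Real.exp 1 * max 1 ‖R w‖) := by gcongr
      _ = Real.exp 1 * (‖f w‖ * max 1 ‖R w‖) := by ring
      _ ≤ _ := by gcongr
  have h1r : 1 - r = s / 2 := by rw [hr, hs]; ring
  have b3 : (p 0).re ≤ 1 + L + 2 / s := by
    rw [norm_mul, norm_exp, h1r] at b2
    have : Real.exp (p 0).re ≤ Real.exp (1 + L + 2 / s) := by
      rw [Real.exp_add, Real.exp_add, hL, Real.exp_log (by positivity)]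
      have h2 : 2 / s ≤ Real.exp (2 / s) := by linarith [Real.add_one_le_exp (2 / s)]
      calc Real.exp (p 0).re ≤ Real.exp 1 * (K / (s / 2)) / ‖f 0‖ := by
            rw [le_div_iff₀ hf0']; linarith
        _ = Real.exp 1 * (K / ‖f 0‖) * (2 / s) := by field_simp
        _ ≤ _ := by gcongr
    exact Real.exp_le_exp.1 this
  have b4 := re_le_harnack hp (r := r) (w := z) (by linarith) zero_le_one
    fun w hw => (hpr w hw).1
  have h2r : r - ‖z‖ = s / 2 := by rw [hr, hs]; ring
  have b5 : (p z).re ≤ 1 + (4 / s) * (2 + L + 2 / s) := by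
    refine b4.trans ?_
    rw [h2r]
    have : (r + ‖z‖) / (s / 2) ≤ 4 / s := by
      rw [div_div_eq_mul_div]
      gcongr
      linarith
    have h0 : 0 ≤ 4 / s := by positivity
    have h3 : (p 0).re + 1 ≤ 2 + L + 2 / s := by linarith
    have h4 : 0 ≤ (2 + L + 2 / s) := by positivity
    have h5 : 0 ≤ (r + ‖z‖) / (s / 2) := by positivity
    have h6 : (r + ‖z‖) / (s / 2) * ((p 0).re + 1) ≤ (4 / s) * (2 + L + 2 / s) :=
      (mul_le_mul_of_nonneg_left h3 h5).trans (mul_le_mul_of_nonneg_right this h4)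
    linarith
  have b6 : ‖R z‖ ≤ Real.exp (1 + (p z).re) := by
    rw [norm_smul, norm_exp, neg_re, Real.exp_neg, inv_mul_le_iff₀ (Real.exp_pos _)] at b1
    rw [add_comm, Real.exp_add]; exact b1
  refine b6.trans (Real.exp_le_exp.2 ?_)
  rw [le_div_iff₀ (by positivity)]
  have e : (1 + (1 + (4 / s) * (2 + L + 2 / s))) * s ^ 2 = 2 * s ^ 2 + 4 * (2 * s + L * s + 2) := by
    field_simp
    ring
  calc (1 + (p z).re) * s ^ 2 ≤ (1 + (1 + (4 / s) * (2 + L + 2 / s))) * s ^ 2 := by gcongr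
    _ ≤ _ := by
      rw [e]
      have : s ≤ 1 := by linarith
      nlinarith

theorem one_div_le_re_inv_pow_three {z : ℂ} (h0 : 0 < z.re) (h : |z.im| ≤ z.re / 2) :
    1 / (8 * z.re ^ 3) ≤ ((z ^ 3)⁻¹).re := by
  obtain ⟨a, b⟩ := z
  simp only at h0 h ⊢
  have hb : b ^ 2 ≤ a ^ 2 / 4 := by
    have := sq_le_sq' (by linarith [abs_nonneg b]) h
    rw [sq_abs] at this
    linarith
  have h1 : (((⟨a, b⟩ : ℂ) ^ 3)⁻¹).re = (a ^ 3 - 3 * a * b ^ 2) / (a ^ 2 + b ^ 2) ^ 3 := by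
    rw [inv_re, map_pow, normSq_mk]
    congr 1
    · simp [pow_succ, Complex.mul_re, Complex.mul_im]; ring
    · ring
  rw [h1, div_le_div_iff₀ (by positivity) (by positivity), one_mul]
  have h2 : (a ^ 2 + b ^ 2) ^ 3 ≤ (5 / 4 * a ^ 2) ^ 3 := by
    gcongr; linarith
  have h3 : a ^ 3 / 4 ≤ a ^ 3 - 3 * a * b ^ 2 := by nlinarith
  have h4 : a ^ 3 / 4 * (8 * a ^ 3) ≤ (a ^ 3 - 3 * a * b ^ 2) * (8 * a ^ 3) := by gcongr
  have h5 : (0 : ℝ) < a ^ 6 := by positivity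
  nlinarith

section Rhombus

variable {V : Type*} [NormedAddCommGroup V] [NormedSpace ℂ V] {F : ℂ → V} {d C : ℝ}

theorem norm_le_of_rhombus (hd : 0 < d) (hC : 0 < C)
    (hF : ∀ w : ℂ, |w.re| + 2 * |w.im| ≤ d → DifferentiableAt ℂ F w)
    (hFb : ∀ w : ℂ, |w.re| + 2 * |w.im| ≤ d → w.im ≠ 0 → ‖F w‖ ≤ Real.exp (C / w.im ^ 2))
    {w : ℂ} (hwr : |w.re| ≤ d / 4) (hwi : |w.im| ≤ d / 4) :
    ‖F w‖ ≤ Real.exp (192 * C / d ^ 2) := by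
  set K := 32 * C * d with hK
  have hK0 : 0 < K := by positivity
  -- the closed rhombus is compact, so `F` is bounded on it
  obtain ⟨M, hM⟩ : ∃ M : ℝ, ∀ w : ℂ, |w.re| + 2 * |w.im| ≤ d → ‖F w‖ ≤ M := by
    have hc : IsCompact {w : ℂ | |w.re| + 2 * |w.im| ≤ d} := by
      refine (isCompact_closedBall (0 : ℂ) d).of_isClosed_subset ?_ fun w hw => ?_
      · exact isClosed_le (by fun_prop) continuous_const
      · rw [mem_closedBall_zero_iff]
        have := norm_le_abs_re_add_abs_im w
        have hw' : |w.re| + 2 * |w.im| ≤ d := hw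
        linarith [abs_nonneg w.im]
    obtain ⟨M, hM⟩ := hc.exists_bound_of_continuousOn (f := F)
      fun w hw => (hF w hw).continuousAt.continuousWithinAt
    exact ⟨M, hM⟩
  obtain ⟨e, he0, hed, heM⟩ : ∃ e : ℝ, 0 < e ∧ e ≤ d / 2 ∧
      Real.exp (-(K * (1 / (8 * e ^ 3)))) * M ≤ 1 := by
    have h1 : Tendsto (fun e : ℝ => K * (1 / (8 * e ^ 3))) (nhdsWithin 0 (Ioi 0)) atTop := by
      refine Tendsto.const_mul_atTop hK0 ?_
      have : Tendsto (fun e : ℝ => 8 * e ^ 3) (nhdsWithin 0 (Ioi 0)) (nhdsWithin 0 (Ioi 0)) := by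
        refine tendsto_nhdsWithin_iff.2 ⟨?_, ?_⟩
        · have : Continuous fun e : ℝ => 8 * e ^ 3 := by fun_prop
          have h := this.tendsto 0
          simp only [ne_eq, OfNat.ofNat_ne_zero, not_false_eq_true, zero_pow, mul_zero] at h
          exact h.mono_left nhdsWithin_le_nhds
        · filter_upwards [self_mem_nhdsWithin] with e he
          have he' : (0 : ℝ) < e := he
          exact mem_Ioi.2 (by positivity)
      simp only [one_div]
      exact tendsto_inv_nhdsGT_zero.comp this
    have h2 : Tendsto (fun e : ℝ => Real.exp (-(K * (1 / (8 * e ^ 3)))) * M)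
        (nhdsWithin 0 (Ioi 0)) (nhds (0 * M)) :=
      (Real.tendsto_exp_neg_atTop_nhds_zero.comp h1).mul_const M
    rw [zero_mul] at h2
    have h3 := h2.eventually (eventually_le_nhds one_pos)
    have h4 : ∀ᶠ e : ℝ in nhdsWithin 0 (Ioi 0), e ≤ d / 2 :=
      nhdsWithin_le_nhds (eventually_le_nhds (by positivity))
    obtain ⟨e, ⟨h5, h6⟩, h7⟩ := ((h3.and h4).and self_mem_nhdsWithin).exists
    exact ⟨e, h7, h6, h5⟩
  let S : ℂ → ℂ := fun w => (((d - w) ^ 3)⁻¹ + ((d + w) ^ 3)⁻¹)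
  have hre : ∀ w : ℂ, |w.re| + 2 * |w.im| ≤ d → |w.re| < d →
      1 / (8 * (d - |w.re|) ^ 3) ≤ (S w).re := by
    intro w hw hw1
    have e1 : ((d : ℂ) - w).re = d - w.re := by simp
    have e2 : ((d : ℂ) + w).re = d + w.re := by simp
    have e3 : |((d : ℂ) - w).im| = |w.im| := by simp
    have e4 : |((d : ℂ) + w).im| = |w.im| := by simp
    have l1 := le_abs_self w.re
    have l2 := neg_abs_le w.re
    have i1 := one_div_le_re_inv_pow_three (z := d - w) (by rw [e1]; linarith)
      (by rw [e1, e3]; linarith)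
    have i2 := one_div_le_re_inv_pow_three (z := d + w) (by rw [e2]; linarith)
      (by rw [e2, e4]; linarith)
    rw [e1] at i1
    rw [e2] at i2
    have p1 : 0 ≤ 1 / (8 * (d - w.re) ^ 3) := by
      have : 0 < d - w.re := by linarith
      positivity
    have p2 : 0 ≤ 1 / (8 * (d + w.re) ^ 3) := by
      have : 0 < d + w.re := by linarith
      positivity
    simp only [S, add_re]
    rcases abs_cases w.re with ⟨h, _⟩ | ⟨h, _⟩
    · rw [h]; linarith
    · rw [h, sub_neg_eq_add]; linarith
  let G : ℂ → V := fun w => exp (-(K * S w)) • F w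
  have hGn : ∀ w, ‖G w‖ = Real.exp (-(K * (S w).re)) * ‖F w‖ := by
    intro w
    simp only [G, norm_smul, norm_exp, neg_re, re_ofReal_mul]
  let U : Set ℂ := {w | |w.re| + 2 * |w.im| < d ∧ |w.re| < d - e}
  let U' : Set ℂ := {w | |w.re| + 2 * |w.im| ≤ d ∧ |w.re| ≤ d - e}
  have hc1 : Continuous fun w : ℂ => |w.re| + 2 * |w.im| := by fun_prop
  have hc2 : Continuous fun w : ℂ => |w.re| := by fun_prop
  have hUo : IsOpen U :=
    (isOpen_lt hc1 continuous_const).inter (isOpen_lt hc2 continuous_const)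
  have hUc : closure U ⊆ U' := by
    refine closure_minimal (fun w hw => ⟨hw.1.le, hw.2.le⟩) ?_
    exact (isClosed_le hc1 continuous_const).inter (isClosed_le hc2 continuous_const)
  have hUb : Bornology.IsBounded U := by
    refine isBounded_ball.subset (t := ball (0 : ℂ) d) fun w hw => ?_
    rw [mem_ball_zero_iff]
    have := norm_le_abs_re_add_abs_im w
    linarith [hw.1, abs_nonneg w.im]
  have hGd : ∀ w ∈ U', DifferentiableAt ℂ G w := by
    intro w hw
    have hlt : |w.re| < d := by linarith [hw.2]
    have l1 := le_abs_self w.re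
    have l2 := neg_abs_le w.re
    have n1 : ((d : ℂ) - w) ^ 3 ≠ 0 := by
      apply pow_ne_zero
      intro h
      have := congrArg Complex.re h
      simp at this
      linarith
    have n2 : ((d : ℂ) + w) ^ 3 ≠ 0 := by
      apply pow_ne_zero
      intro h
      have := congrArg Complex.re h
      simp at this
      linarith
    have hS : DifferentiableAt ℂ S w :=
      ((by fun_prop : DifferentiableAt ℂ (fun w : ℂ => ((d : ℂ) - w) ^ 3) w).inv n1).add
        ((by fun_prop : DifferentiableAt ℂ (fun w : ℂ => ((d : ℂ) + w) ^ 3) w).inv n2)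
    exact ((hS.const_mul (K : ℂ)).neg.cexp).smul (hF w hw.1)
  have hmax : ‖G w‖ ≤ 1 := by
    refine Complex.norm_le_of_forall_mem_frontier_norm_le hUb
      (DifferentiableOn.diffContOnCl fun z hz => (hGd z (hUc hz)).differentiableWithinAt)
      (fun z hz => ?_) (subset_closure (⟨by linarith, by linarith⟩ : w ∈ U))
    rw [frontier, hUo.interior_eq] at hz
    have hz1 := hUc hz.1
    have hz2 : ¬ (|z.re| + 2 * |z.im| < d ∧ |z.re| < d - e) := hz.2
    have hlt : |z.re| < d := by linarith [hz1.2]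
    have hSz := hre z hz1.1 hlt
    rw [hGn]
    by_cases hcase : |z.re| < d - e
    · have heq : |z.re| + 2 * |z.im| = d :=
        le_antisymm hz1.1 (not_lt.1 fun h => hz2 ⟨h, hcase⟩)
      have him : 0 < |z.im| := by linarith
      have hF1 := hFb z hz1.1 (abs_pos.1 him)
      calc _ ≤ Real.exp (-(K * (S z).re)) * Real.exp (C / z.im ^ 2) := by gcongr
        _ = Real.exp (-(K * (S z).re) + C / z.im ^ 2) := by rw [Real.exp_add]
        _ ≤ 1 := Real.exp_le_one_iff.2 ?_
      have h1 : d - |z.re| = 2 * |z.im| := by linarith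
      rw [h1] at hSz
      have h2 : K * (1 / (8 * (2 * |z.im|) ^ 3)) ≤ K * (S z).re := by gcongr
      have h3 : C / z.im ^ 2 ≤ K * (1 / (8 * (2 * |z.im|) ^ 3)) := by
        rw [← sq_abs, hK, mul_one_div, div_le_div_iff₀ (by positivity) (by positivity)]
        have : 2 * |z.im| ≤ d := by linarith [abs_nonneg z.re]
        have h4 : 0 ≤ C * |z.im| ^ 2 := by positivity
        nlinarith [mul_le_mul_of_nonneg_left this h4]
      linarith
    · have heq : |z.re| = d - e := le_antisymm hz1.2 (not_lt.1 hcase)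
      have h1 : d - |z.re| = e := by linarith
      rw [h1] at hSz
      have hM0 : 0 ≤ M := (norm_nonneg _).trans (hM z hz1.1)
      calc _ ≤ Real.exp (-(K * (1 / (8 * e ^ 3)))) * M := by
            gcongr
            exact hM z hz1.1
        _ ≤ 1 := heM
  rw [hGn, Real.exp_neg, inv_mul_le_iff₀ (Real.exp_pos _), mul_one] at hmax
  refine hmax.trans (Real.exp_le_exp.2 ?_)
  have l1 := le_abs_self w.re
  have l2 := neg_abs_le w.re
  have hb : ∀ u : ℂ, 3 / 4 * d ≤ u.re → ((u ^ 3)⁻¹).re ≤ 1 / (3 / 4 * d) ^ 3 := by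
    intro u hu
    have h1 : 3 / 4 * d ≤ ‖u‖ := hu.trans (re_le_norm u)
    calc _ ≤ ‖(u ^ 3)⁻¹‖ := re_le_norm _
      _ = 1 / ‖u‖ ^ 3 := by simp
      _ ≤ _ := by gcongr
  have h1 := hb (d - w) (by simp; linarith)
  have h2 := hb (d + w) (by simp; linarith)
  have h3 : (S w).re ≤ 2 * (1 / (3 / 4 * d) ^ 3) := by
    simp only [S, add_re]; linarith
  calc K * (S w).re ≤ K * (2 * (1 / (3 / 4 * d) ^ 3)) := by gcongr
    _ = (32 * 128 / 27) * C / d ^ 2 := by rw [hK]; field_simp; norm_num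
    _ ≤ _ := by gcongr; norm_num

theorem norm_le_of_annulus {A : ℝ} (hd : 0 < d) (hd1 : d ≤ 1) (hA : 1 ≤ A)
    (hF : ∀ w : ℂ, |w.re| ≤ d / 4 → |w.im| ≤ d / 4 → DifferentiableAt ℂ F w)
    (hFA : ∀ w : ℂ, |w.re| ≤ d / 4 → |w.im| ≤ d / 4 → ‖F w‖ ≤ Real.exp A)
    (hFi : ∀ w : ℂ, |w.re| ≤ d / 4 → |w.im| ≤ d / 4 → w.im < 0 → ‖F w‖ ≤ 1 / (-w.im))
    {w : ℂ} (hw : ‖w‖ < d / (96 * A)) : ‖F w‖ ≤ 768 * A / d := by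
  set N : ℕ := ⌈3 * A⌉₊ with hN
  have hN1 : 3 * A ≤ N := Nat.le_ceil _
  have hN2 : (N : ℝ) ≤ 4 * A := by
    have := Nat.ceil_lt_add_one (a := 3 * A) (by linarith)
    linarith
  have hN0 : (0 : ℝ) < N := by linarith
  set t : ℝ := 1 / (2 * N) with ht
  have ht0 : 0 < t := by positivity
  have htN : t * N = 1 / 2 := by rw [ht]; field_simp
  have ht6 : t ≤ 1 / 6 := by nlinarith
  set r : ℝ := d / 12 with hr
  have hr0 : 0 < r := by positivity
  set c : ℂ := -(r * I) with hc
  have hcre : ∀ z : ℂ, (z - c).re = z.re := by intro z; simp [hc]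
  have hcim : ∀ z : ℂ, (z - c).im = z.im + r := by intro z; simp [hc]
  have hcn : ‖c‖ = r := by simp [hc, abs_of_pos hr0]
  have hw' : ‖w‖ < r * t := by
    refine hw.trans_le ?_
    rw [hr, ht, div_mul_div_comm, mul_one]
    exact div_le_div_of_nonneg_left hd.le (by positivity) (by linarith)
  have hbox : ∀ z : ℂ, ‖z - c‖ ≤ 2 * r → |z.re| ≤ d / 4 ∧ |z.im| ≤ d / 4 := by
    intro z hz
    have h1 := (abs_re_le_norm (z - c)).trans hz
    have h2 := (abs_im_le_norm (z - c)).trans hz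
    rw [hcre] at h1
    rw [hcim] at h2
    rw [abs_le] at h1 h2 ⊢
    rw [abs_le]
    exact ⟨⟨by linarith, by linarith⟩, ⟨by linarith, by linarith⟩⟩
  let G : ℂ → V := fun z => ((z - c) ^ N)⁻¹ • F z
  let U : Set ℂ := {z | r * (1 - t) < ‖z - c‖ ∧ ‖z - c‖ < 2 * r}
  let U' : Set ℂ := {z | r * (1 - t) ≤ ‖z - c‖ ∧ ‖z - c‖ ≤ 2 * r}
  have hc1 : Continuous fun z : ℂ => ‖z - c‖ := by fun_prop
  have hUo : IsOpen U :=
    (isOpen_lt continuous_const hc1).inter (isOpen_lt hc1 continuous_const)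
  have hUc : closure U ⊆ U' := by
    refine closure_minimal (fun w hw => ⟨hw.1.le, hw.2.le⟩) ?_
    exact (isClosed_le continuous_const hc1).inter (isClosed_le hc1 continuous_const)
  have hUb : Bornology.IsBounded U := by
    refine isBounded_ball.subset (t := ball c (2 * r)) fun w hw => ?_
    rw [mem_ball_iff_norm]
    exact hw.2
  have hrt : 0 < r * (1 - t) := mul_pos hr0 (by linarith)
  have hGd : ∀ z ∈ U', DifferentiableAt ℂ G z := by
    intro z hz
    have h1 : (z - c) ^ N ≠ 0 := pow_ne_zero _ (norm_pos_iff.1 (hrt.trans_le hz.1))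
    have hb := hbox z hz.2
    exact ((by fun_prop : DifferentiableAt ℂ (fun z : ℂ => (z - c) ^ N) z).inv h1).smul
      (hF z hb.1 hb.2)
  have hwc1 : ‖w - c‖ ≤ r * (1 + t) := by
    have := norm_sub_le w c
    rw [hcn] at this
    linarith
  have hwc2 : r * (1 - t) < ‖w - c‖ := by
    have := norm_sub_norm_le c w
    rw [hcn, norm_sub_rev] at this
    linarith
  have hpos : 0 < r * (1 + t) := by positivity
  have hconst1 : Real.exp A ≤ (2 / (1 + t)) ^ N := by
    have h1 : Real.exp (1 / 3) ≤ 12 / 7 := by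
      rw [← pow_le_pow_iff_left₀ (Real.exp_pos _).le (by norm_num) three_ne_zero, ← Real.exp_nat_mul]
      norm_num
      linarith [Real.exp_one_lt_d9]
    have h2 : (12 / 7 : ℝ) ≤ 2 / (1 + t) := by
      rw [div_le_div_iff₀ (by norm_num) (by positivity)]; linarith
    calc Real.exp A ≤ Real.exp (N * (1 / 3)) := Real.exp_le_exp.2 (by linarith)
      _ = Real.exp (1 / 3) ^ N := Real.exp_nat_mul _ _
      _ ≤ _ := by gcongr; exact h1.trans h2
  have hconst2 : (1 + t) ^ N ≤ 8 * (1 - t) ^ N := by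
    have h1 : (1 + t) ≤ Real.exp (4 * t) * (1 - t) := by
      have := Real.add_one_le_exp (4 * t)
      nlinarith
    calc (1 + t) ^ N ≤ (Real.exp (4 * t) * (1 - t)) ^ N := by gcongr
      _ = Real.exp 2 * (1 - t) ^ N := by
        rw [mul_pow, ← Real.exp_nat_mul]
        congr 2
        linarith
      _ ≤ 8 * (1 - t) ^ N := by
        have : 0 ≤ 1 - t := by linarith
        gcongr
        have h2 : Real.exp 2 = Real.exp 1 * Real.exp 1 := by rw [← Real.exp_add]; norm_num
        rw [h2]
        nlinarith [Real.exp_one_lt_d9, Real.exp_pos 1]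
  have hrt1 : r * t ≤ 1 := by nlinarith
  have hmax : ‖G w‖ ≤ ((r * (1 + t)) ^ N)⁻¹ * (8 / (r * t)) := by
    refine Complex.norm_le_of_forall_mem_frontier_norm_le hUb
      (DifferentiableOn.diffContOnCl fun z hz => (hGd z (hUc hz)).differentiableWithinAt)
      (fun z hz => ?_) (subset_closure (⟨hwc2, by nlinarith⟩ : w ∈ U))
    · rw [frontier, hUo.interior_eq] at hz
      have hz1 := hUc hz.1
      have hz2 : ¬ (r * (1 - t) < ‖z - c‖ ∧ ‖z - c‖ < 2 * r) := hz.2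
      have hb := hbox z hz1.2
      simp only [G, norm_smul, norm_inv, norm_pow]
      by_cases hcase : r * (1 - t) < ‖z - c‖
      · have heq : ‖z - c‖ = 2 * r := le_antisymm hz1.2 (not_lt.1 fun h => hz2 ⟨hcase, h⟩)
        rw [heq]
        calc _ ≤ ((2 * r) ^ N)⁻¹ * (2 / (1 + t)) ^ N := by
              gcongr; exact (hFA z hb.1 hb.2).trans hconst1
          _ = ((r * (1 + t)) ^ N)⁻¹ := by
            rw [← inv_pow, ← mul_pow, ← inv_pow]
            congr 1
            field_simp
          _ ≤ _ := by
            refine le_mul_of_one_le_right (by positivity) ?_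
            rw [one_le_div (by positivity)]; linarith
      · have heq : ‖z - c‖ = r * (1 - t) := le_antisymm (not_lt.1 hcase) hz1.1
        have h2 := (abs_im_le_norm (z - c))
        rw [heq, hcim] at h2
        have h3 : z.im ≤ -(r * t) := by
          have := le_abs_self (z.im + r)
          linarith
        have hrt' : 0 < r * t := by positivity
        have h4 : ‖F z‖ ≤ 1 / (r * t) := by
          refine (hFi z hb.1 hb.2 (by linarith)).trans ?_
          gcongr
          linarith
        rw [heq]
        calc _ ≤ ((r * (1 - t)) ^ N)⁻¹ * (1 / (r * t)) := by gcongr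
          _ ≤ ((r * (1 + t)) ^ N)⁻¹ * 8 * (1 / (r * t)) := by
            gcongr
            rw [inv_mul_eq_div, inv_eq_one_div, div_le_div_iff₀ (by positivity)
              (by positivity), mul_pow, mul_pow, one_mul]
            nlinarith [pow_pos hr0 N]
          _ = _ := by ring
  simp only [G, norm_smul, norm_inv, norm_pow] at hmax
  have hwcp : 0 < ‖w - c‖ := hrt.trans hwc2
  rw [inv_mul_le_iff₀ (by positivity)] at hmax
  refine hmax.trans ?_
  calc ‖w - c‖ ^ N * (((r * (1 + t)) ^ N)⁻¹ * (8 / (r * t)))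
      ≤ (r * (1 + t)) ^ N * (((r * (1 + t)) ^ N)⁻¹ * (8 / (r * t))) := by gcongr
    _ = 8 / (r * t) := by rw [← mul_assoc, mul_inv_cancel₀ (by positivity), one_mul]
    _ = 192 * N / d := by rw [hr, ht]; field_simp; norm_num
    _ ≤ _ := div_le_div_of_nonneg_right (by linarith) hd.le

end Rhombus

section ResolventGrowth

variable {B : Type*} [NormedRing B] [NormedAlgebra ℂ B] [CompleteSpace B] {T : B} {E : Set ℂ}

theorem exists_norm_resolvent_le_near (hT : ∀ n, ‖T ^ n‖ ≤ 1)
    (hres : ∀ l ∉ E, l ∈ resolventSet ℂ T) {C : ℝ} (hC : 1 ≤ C)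
    (hexp : ∀ z ∈ ball (0 : ℂ) 1, ‖resolvent T z‖ ≤ Real.exp (C / (1 - ‖z‖) ^ 2))
    {x : ℝ} {d : ℝ} (hd : 0 < d) (hd1 : d ≤ 1 / 2)
    (hdist : ∀ e ∈ E, 4 * d ≤ ‖exp (x * I) - e‖)
    {w : ℂ} (hw : ‖w‖ < d ^ 3 / (73728 * C)) :
    ‖resolvent T (exp (x * I) * exp (w * I))‖ ≤ 589824 * C / d ^ 3 := by
  let F : ℂ → B := fun w => resolvent T (exp (x * I) * exp (w * I))
  have hx1 : ‖exp (x * I)‖ = 1 := norm_exp_ofReal_mul_I x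
  have hnorm : ∀ w : ℂ, ‖exp (x * I) * exp (w * I)‖ = Real.exp (-w.im) := by
    intro w
    rw [norm_mul, hx1, one_mul, norm_exp]
    simp
  have hnE : ∀ w : ℂ, ‖w‖ ≤ d → exp (x * I) * exp (w * I) ∉ E := by
    intro w hw hmem
    have h1 := hdist _ hmem
    have h2 : ‖exp (w * I) - 1‖ ≤ 2 * ‖w * I‖ :=
      Complex.norm_exp_sub_one_le (by simp; linarith)
    have h3 : exp (x * I) - exp (x * I) * exp (w * I) = -(exp (x * I) * (exp (w * I) - 1)) := by
      ring
    rw [h3, norm_neg, norm_mul, hx1, one_mul] at h1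
    simp only [norm_mul, norm_I, mul_one] at h2
    linarith
  have hFd : ∀ w : ℂ, ‖w‖ ≤ d → DifferentiableAt ℂ F w := by
    intro w hw
    have h1 : DifferentiableAt ℂ (resolvent T) (exp (x * I) * exp (w * I)) :=
      differentiableOn_resolvent.differentiableAt
        ((spectrum.isOpen_resolventSet T).mem_nhds (hres _ (hnE w hw)))
    exact h1.comp (f := fun w : ℂ => exp (x * I) * exp (w * I)) w (by fun_prop)
  have hout : ∀ w : ℂ, w.im < 0 → ‖F w‖ ≤ 1 / (-w.im) := by
    intro w hw
    have h1 : 1 - w.im ≤ Real.exp (-w.im) := by linarith [Real.add_one_le_exp (-w.im)]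
    refine (norm_resolvent_le_of_one_lt hT (by rw [hnorm]; linarith)).trans ?_
    rw [hnorm]
    exact one_div_le_one_div_of_le (by linarith) (by linarith)
  have hin : ∀ w : ℂ, w.im ≠ 0 → |w.im| ≤ 1 → ‖F w‖ ≤ Real.exp (4 * C / w.im ^ 2) := by
    intro w h0 h1
    rcases lt_or_gt_of_ne h0 with h | h
    · refine (hout w h).trans ?_
      rw [abs_of_neg h] at h1
      have h2 : 1 / (-w.im) ≤ 4 * C / w.im ^ 2 := by
        rw [div_le_div_iff₀ (by linarith) (by positivity)]
        nlinarith
      linarith [Real.add_one_le_exp (4 * C / w.im ^ 2)]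
    · rw [abs_of_pos h] at h1
      have h2 : Real.exp (-w.im) ≤ 1 - w.im / 2 := by
        have h3 := Real.add_one_le_exp w.im
        rw [Real.exp_neg, inv_le_comm₀ (Real.exp_pos _) (by linarith)]
        refine le_trans ?_ h3
        rw [inv_le_iff_one_le_mul₀ (by linarith)]
        nlinarith
      have h4 : exp (x * I) * exp (w * I) ∈ ball (0 : ℂ) 1 := by
        rw [mem_ball_zero_iff, hnorm]; linarith
      refine (hexp _ h4).trans (Real.exp_le_exp.2 ?_)
      rw [hnorm]
      calc C / (1 - Real.exp (-w.im)) ^ 2 ≤ C / (w.im / 2) ^ 2 := by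
            gcongr; linarith
        _ = 4 * C / w.im ^ 2 := by field_simp; norm_num
  have hbox : ∀ w : ℂ, |w.re| ≤ d / 4 → |w.im| ≤ d / 4 → ‖w‖ ≤ d := by
    intro w h1 h2
    have := norm_le_abs_re_add_abs_im w
    linarith
  have hrh : ∀ w : ℂ, |w.re| + 2 * |w.im| ≤ d → ‖w‖ ≤ d := by
    intro w h1
    have := norm_le_abs_re_add_abs_im w
    linarith [abs_nonneg w.im]
  have hA : ∀ w : ℂ, |w.re| ≤ d / 4 → |w.im| ≤ d / 4 →
      ‖F w‖ ≤ Real.exp (192 * (4 * C) / d ^ 2) := fun w h1 h2 =>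
    norm_le_of_rhombus (F := F) hd (by linarith) (fun w hw => hFd w (hrh w hw))
      (fun w hw h0 => hin w h0 (by linarith [abs_nonneg w.re, abs_nonneg w.im])) h1 h2
  have hA1 : 1 ≤ 192 * (4 * C) / d ^ 2 := by
    rw [one_le_div (by positivity)]; nlinarith
  have := norm_le_of_annulus (F := F) hd (by linarith) hA1 (fun w h1 h2 => hFd w (hbox w h1 h2)) hA
    (fun w _ _ h => hout w h) (w := w) (by
      refine hw.trans_le (le_of_eq ?_)
      field_simp
      norm_num)
  refine this.trans (le_of_eq ?_)
  field_simp
  norm_num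

theorem exists_resolvent_growth (hT : ∀ n, ‖T ^ n‖ ≤ 1) (hEne : E.Nonempty)
    (hE : E ⊆ sphere 0 1) (hres : ∀ l ∉ E, l ∈ resolventSet ℂ T)
    (hexp : ∃ C, ∀ z ∈ ball (0 : ℂ) 1, ‖resolvent T z‖ ≤ Real.exp (C / (1 - ‖z‖) ^ 2)) :
    ∃ C, 1 ≤ C ∧ ∀ l ∉ E, 1 / 2 ≤ ‖l‖ → ‖l‖ ≤ 2 →
      ‖resolvent T l‖ * infDist l E ^ 3 ≤ C ∨ infDist l E ^ 3 ≤ C * |‖l‖ - 1| := by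
  obtain ⟨C₀, hC₀⟩ := hexp
  obtain ⟨C, hC, hexp⟩ : ∃ C : ℝ, 1 ≤ C ∧ ∀ z ∈ ball (0 : ℂ) 1,
      ‖resolvent T z‖ ≤ Real.exp (C / (1 - ‖z‖) ^ 2) := by
    refine ⟨max C₀ 1, le_max_right _ _, fun z hz => (hC₀ z hz).trans (Real.exp_le_exp.2 ?_)⟩
    gcongr
    exact le_max_left _ _
  refine ⟨10 ^ 12 * C, by linarith, fun l hl h1 h2 => ?_⟩
  have hl0 : 0 < ‖l‖ := by linarith
  set ζ : ℂ := exp (l.arg * I) with hζ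
  have hlζ : l = ‖l‖ * ζ := (norm_mul_exp_arg_mul_I l).symm
  have hζ1 : ‖ζ‖ = 1 := norm_exp_ofReal_mul_I _
  set D := infDist ζ E with hD
  have hD0 : 0 ≤ D := infDist_nonneg
  have hD2 : D ≤ 2 := by
    obtain ⟨e, he⟩ := hEne
    refine (infDist_le_dist_of_mem he).trans ?_
    rw [dist_eq_norm]
    have := norm_sub_le ζ e
    have he1 : ‖e‖ = 1 := by simpa using hE he
    linarith
  set m := |‖l‖ - 1| with hm
  have hm1 : m ≤ 1 := abs_le.2 ⟨by linarith, by linarith⟩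
  have hm0 : 0 ≤ m := abs_nonneg _
  have hlD : infDist l E ≤ D + m := by
    have h3 := infDist_le_infDist_add_dist (s := E) (x := l) (y := ζ)
    have h4 : dist l ζ = m := by
      rw [dist_eq_norm]
      nth_rewrite 1 [hlζ]
      rw [show (‖l‖ : ℂ) * ζ - ζ = ((‖l‖ - 1 : ℝ) : ℂ) * ζ by push_cast; ring, norm_mul, hζ1,
        mul_one, norm_real, Real.norm_eq_abs]
    rw [h4] at h3
    exact h3
  have hi0 : 0 ≤ infDist l E := infDist_nonneg
  have hlog : |Real.log ‖l‖| ≤ 2 * m := by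
    rw [abs_le]
    have h3 := Real.log_le_sub_one_of_pos hl0
    have h4 := Real.one_sub_inv_le_log_of_pos hl0
    have h5 : ‖l‖⁻¹ * ‖l‖ = 1 := inv_mul_cancel₀ hl0.ne'
    have h6 : ‖l‖⁻¹ ≤ 2 := by
      rw [inv_le_comm₀ hl0 two_pos]; linarith
    have h7 : 0 ≤ ‖l‖⁻¹ := by positivity
    have h8 := le_abs_self (‖l‖ - 1)
    have h9 := neg_abs_le (‖l‖ - 1)
    rw [← hm] at h8 h9
    have h10 : 1 - ‖l‖⁻¹ = ‖l‖⁻¹ * (‖l‖ - 1) := by rw [mul_sub, h5]; ring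
    constructor
    · rw [h10] at h4
      nlinarith
    · linarith
  by_cases hcase : |Real.log ‖l‖| < (D / 4) ^ 3 / (73728 * C)
  · left
    have hDpos : 0 < D := by
      rcases hD0.lt_or_eq with h | h
      · exact h
      · rw [← h] at hcase
        norm_num at hcase
        linarith [abs_nonneg (Real.log ‖l‖)]
    have hlw : l = exp (l.arg * I) * exp (-(Real.log ‖l‖ * I) * I) := by
      have h3 : -((Real.log ‖l‖ : ℂ) * I) * I = (Real.log ‖l‖ : ℂ) := by
        rw [neg_mul, mul_assoc, I_mul_I]; ring
      rw [h3, ← ofReal_exp, Real.exp_log hl0, mul_comm]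
      exact hlζ
    have h3 := exists_norm_resolvent_le_near hT hres hC hexp (x := l.arg) (d := D / 4)
      (by positivity) (by linarith)
      (fun e he => by
        have := infDist_le_dist_of_mem (x := ζ) he
        rw [dist_eq_norm] at this
        linarith)
      (w := -(Real.log ‖l‖ * I)) (by simpa using hcase)
    rw [← hlw] at h3
    have h4 : infDist l E ≤ 2 * D := by
      by_contra! hcon
      have h5 : D < m := by linarith
      have h6 : m ≤ 2 * |Real.log ‖l‖| := by
        rcases le_total 1 ‖l‖ with h | h
        · rw [hm, abs_of_nonneg (by linarith), abs_of_nonneg (Real.log_nonneg h)]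
          have h7 := Real.one_sub_inv_le_log_of_pos hl0
          have h8 : 1 / ‖l‖ * ‖l‖ = 1 := one_div_mul_cancel hl0.ne'
          have h9 : 1 / 2 ≤ 1 / ‖l‖ := one_div_le_one_div_of_le hl0 h2
          rw [inv_eq_one_div] at h7
          nlinarith
        · rw [hm, abs_of_nonpos (by linarith), abs_of_nonpos (Real.log_nonpos hl0.le h)]
          have h3 := Real.log_le_sub_one_of_pos hl0
          linarith
      have h7 : (D / 4) ^ 3 / (73728 * C) ≤ D / 4 := by
        rw [div_le_iff₀ (by positivity)]
        have : (D / 4) ^ 2 ≤ 1 := by nlinarith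
        nlinarith
      linarith
    calc ‖resolvent T l‖ * infDist l E ^ 3 ≤ (589824 * C / (D / 4) ^ 3) * (2 * D) ^ 3 := by gcongr
      _ = 589824 * 512 * C := by field_simp; norm_num
      _ ≤ _ := by linarith
  · right
    rw [not_lt, div_le_iff₀ (by positivity)] at hcase
    have h3 : D ^ 3 ≤ 64 * (2 * m * (73728 * C)) := by
      have : |Real.log ‖l‖| * (73728 * C) ≤ 2 * m * (73728 * C) := by gcongr
      nlinarith
    have h4 : infDist l E ^ 3 ≤ (D + m) ^ 3 := by gcongr
    have h5 : (D + m) ^ 3 ≤ 4 * (D ^ 3 + m ^ 3) := by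
      nlinarith [mul_nonneg (add_nonneg hD0 hm0) (sq_nonneg (D - m))]
    have h6 : m ^ 3 ≤ m := by
      calc m ^ 3 ≤ m ^ 1 := pow_le_pow_of_le_one hm0 hm1 (by norm_num)
        _ = m := pow_one m
    nlinarith

theorem exists_resolvent_growth_weighted (hT : ∀ n, ‖T ^ n‖ ≤ 1) (hEc : IsClosed E)
    (hEne : E.Nonempty)
    (hE : E ⊆ sphere 0 1) (hres : ∀ l ∉ E, l ∈ resolventSet ℂ T)
    (hexp : ∃ C, ∀ z ∈ ball (0 : ℂ) 1, ‖resolvent T z‖ ≤ Real.exp (C / (1 - ‖z‖) ^ 2)) :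
    ∃ C, 1 ≤ C ∧ (∀ l ∉ E, 1 ≤ ‖l‖ → ‖l‖ ≤ 2 → ‖resolvent T l‖ * infDist l E ^ 3 ≤ C) ∧
      ∀ l : ℂ, ‖l‖ < 1 → ∀ (c : ℂ) (K : ℝ), ‖c‖ ≤ K → ‖c • resolvent T l‖ ≤ K / (1 - ‖l‖) →
        ‖c • resolvent T l‖ * infDist l E ^ 3 ≤ C * K := by
  obtain ⟨C, hC, h⟩ := exists_resolvent_growth hT hEne hE hres hexp
  refine ⟨16 * C, by linarith, fun l hl h1 h2 => ?_, fun l hl c K hcK hK => ?_⟩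
  · rcases h l hl (by linarith) h2 with h3 | h3
    · linarith
    · rcases h1.eq_or_lt with h4 | h4
      · exfalso
        rw [← h4] at h3
        have h5 : infDist l E = 0 := by
          have : infDist l E ^ 3 = 0 := le_antisymm (by simpa using h3) (by
            have := infDist_nonneg (x := l) (s := E); positivity)
          exact pow_eq_zero_iff three_ne_zero |>.1 this
        exact hl ((hEc.mem_iff_infDist_zero hEne).2 h5)
      · have h5 := norm_resolvent_le_of_one_lt hT h4
        rw [abs_of_pos (by linarith)] at h3
        have h6 : 0 < ‖l‖ - 1 := by linarith
        calc ‖resolvent T l‖ * infDist l E ^ 3 ≤ 1 / (‖l‖ - 1) * (C * (‖l‖ - 1)) := by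
              have := infDist_nonneg (x := l) (s := E)
              gcongr
          _ = C := by field_simp
          _ ≤ _ := by linarith
  · have hK0 : 0 ≤ K := (norm_nonneg _).trans hcK
    have h0 : 0 < 1 - ‖l‖ := by linarith
    have hi : infDist l E ≤ 2 := by
      obtain ⟨e, he⟩ := hEne
      refine (infDist_le_dist_of_mem he).trans ?_
      rw [dist_eq_norm]
      have := norm_sub_le l e
      have he1 : ‖e‖ = 1 := by simpa using hE he
      linarith
    have hi0 : 0 ≤ infDist l E := infDist_nonneg
    have hlE : l ∉ E := fun hmem => by
      have : ‖l‖ = 1 := by simpa using hE hmem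
      linarith
    rcases lt_or_ge ‖l‖ (1 / 2) with h1 | h1
    · have h2 : K / (1 - ‖l‖) ≤ 2 * K := by
        rw [div_le_iff₀ h0]
        nlinarith
      calc ‖c • resolvent T l‖ * infDist l E ^ 3 ≤ (2 * K) * 2 ^ 3 := by
            gcongr
            exact hK.trans h2
        _ ≤ 16 * C * K := by nlinarith
    · rcases h l hlE h1 (by linarith) with h3 | h3
      · rw [norm_smul, mul_assoc]
        calc ‖c‖ * (‖resolvent T l‖ * infDist l E ^ 3) ≤ K * C := by gcongr
          _ ≤ _ := by nlinarith [mul_nonneg hK0 (by linarith : 0 ≤ C)]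
      · rw [abs_of_neg (by linarith)] at h3
        calc ‖c • resolvent T l‖ * infDist l E ^ 3 ≤ K / (1 - ‖l‖) * (C * (1 - ‖l‖)) := by
              gcongr
              linarith
          _ = C * K := by field_simp
          _ ≤ _ := by nlinarith [mul_nonneg hK0 (by linarith : 0 ≤ C)]

end ResolventGrowth

section Flatness

variable {E : Set ℂ}

theorem norm_le_infDist_pow_succ {h H : ℂ → ℂ} {M : ℝ} {k : ℕ} (hEc : IsClosed E)
    (hEne : E.Nonempty) (hE : E ⊆ closedBall 0 1) (hh : DifferentiableOn ℂ h (ball 0 1))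
    (hH : ContinuousOn H (closedBall 0 1)) (hHh : EqOn H h (ball 0 1)) (hHE : ∀ z ∈ E, H z = 0)
    (hd : ∀ z ∈ ball (0 : ℂ) 1, ‖deriv h z‖ ≤ M * infDist z E ^ k) {z : ℂ} (hz : z ∈ ball (0 : ℂ) 1) :
    ‖h z‖ ≤ M * infDist z E ^ (k + 1) := by
  obtain ⟨ζ, hζE, hζ⟩ := hEc.exists_infDist_eq_dist hEne z
  have hM : 0 ≤ M * infDist z E ^ k := (norm_nonneg _).trans (hd z hz)
  rcases (infDist_nonneg (x := z) (s := E)).eq_or_lt with h0 | h0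
  · have hzE : z ∈ E := (hEc.mem_iff_infDist_zero hEne).2 h0.symm
    rw [← hHh hz, hHE z hzE, norm_zero, ← h0]
    simp
  have hM0 : 0 ≤ M := nonneg_of_mul_nonneg_left hM (by positivity)
  have hbound : ∀ t ∈ Ioo (0 : ℝ) 1, ‖h (z + t * (ζ - z)) - h z‖ ≤ M * infDist z E ^ k * infDist z E := by
    intro t ht
    have hmem : z + t * (ζ - z) ∈ ball (0 : ℂ) 1 ∩ closedBall ζ (infDist z E) := by
      have e1 : z + t * (ζ - z) = ((1 - t : ℝ) : ℂ) * z + t * ζ := by push_cast; ring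
      have e2 : z + t * (ζ - z) - ζ = ((1 - t : ℝ) : ℂ) * (z - ζ) := by push_cast; ring
      have hζ1 : ‖ζ‖ ≤ 1 := by simpa using hE hζE
      have hz1 : ‖z‖ < 1 := by simpa using hz
      have n1 : ‖((1 - t : ℝ) : ℂ)‖ = 1 - t := by
        rw [norm_real, Real.norm_eq_abs, abs_of_pos (by linarith [ht.2])]
      have n2 : ‖(t : ℂ)‖ = t := by rw [norm_real, Real.norm_eq_abs, abs_of_pos ht.1]
      refine ⟨?_, ?_⟩
      · rw [mem_ball_zero_iff, e1]
        refine (norm_add_le _ _).trans_lt ?_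
        rw [norm_mul, norm_mul, n1, n2]
        nlinarith [ht.1, ht.2]
      · rw [mem_closedBall, dist_eq_norm, e2, norm_mul, n1, ← dist_eq_norm, ← hζ]
        nlinarith [ht.1]
    have hmv := (convex_ball (0 : ℂ) 1).inter (convex_closedBall ζ (infDist z E)) |>.norm_image_sub_le_of_norm_deriv_le
      (f := h) (𝕜 := ℂ) (C := M * infDist z E ^ k)
      (fun w hw => hh.differentiableAt (isOpen_ball.mem_nhds hw.1))
      (fun w hw => (hd w hw.1).trans (by
        have h1 : infDist w E ≤ infDist z E := (infDist_le_dist_of_mem hζE).trans (mem_closedBall.1 hw.2)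
        have := infDist_nonneg (x := w) (s := E)
        gcongr))
      (x := z) ⟨hz, by rw [mem_closedBall, hζ]⟩ hmem
    refine hmv.trans ?_
    gcongr
    have e3 : z + t * (ζ - z) - z = (t : ℂ) * (ζ - z) := by ring
    rw [e3, norm_mul, norm_real, Real.norm_eq_abs, abs_of_pos ht.1, hζ, dist_comm, dist_eq_norm]
    nlinarith [norm_nonneg (ζ - z), ht.2]
  have htend : Tendsto (fun t : ℝ => z + t * (ζ - z)) (nhdsWithin 1 (Iio 1))
      (nhdsWithin ζ (closedBall 0 1)) := by
    refine tendsto_nhdsWithin_iff.2 ⟨?_, ?_⟩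
    · have : Continuous fun t : ℝ => z + t * (ζ - z) := by fun_prop
      have h1 := this.tendsto 1
      simp only [ofReal_one, one_mul, add_sub_cancel] at h1
      exact h1.mono_left nhdsWithin_le_nhds
    · filter_upwards [Ioo_mem_nhdsLT (zero_lt_one' ℝ)] with t ht
      have := (convex_closedBall (0 : ℂ) 1).add_smul_sub_mem (ball_subset_closedBall hz) (hE hζE)
        ⟨ht.1.le, ht.2.le⟩
      simpa using this
  have hlim : Tendsto (fun t : ℝ => ‖H (z + t * (ζ - z)) - h z‖) (nhdsWithin 1 (Iio 1))
      (nhds ‖H ζ - h z‖) :=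
    (((hH ζ (hE hζE)).tendsto.comp htend).sub_const _).norm
  rw [hHE ζ hζE, zero_sub, norm_neg] at hlim
  rw [pow_succ, ← mul_assoc]
  refine le_of_tendsto hlim ?_
  filter_upwards [Ioo_mem_nhdsLT (zero_lt_one' ℝ)] with t ht
  have hmem : z + t * (ζ - z) ∈ ball (0 : ℂ) 1 := by
    have hζ1 : ‖ζ‖ ≤ 1 := by simpa using hE hζE
    have hz1 : ‖z‖ < 1 := by simpa using hz
    have e1 : z + t * (ζ - z) = ((1 - t : ℝ) : ℂ) * z + t * ζ := by push_cast; ring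
    rw [mem_ball_zero_iff, e1]
    refine (norm_add_le _ _).trans_lt ?_
    rw [norm_mul, norm_mul, norm_real, norm_real, Real.norm_eq_abs, Real.norm_eq_abs,
      abs_of_pos ht.1, abs_of_pos (by linarith [ht.2])]
    nlinarith [ht.1, ht.2]
  rw [hHh hmem]
  exact hbound t ht

theorem DifferentiableOn.iteratedDeriv_ball {g : ℂ → ℂ} (hg : DifferentiableOn ℂ g (ball 0 1)) (n : ℕ) :
    DifferentiableOn ℂ (iteratedDeriv n g) (ball 0 1) := by
  induction n with
  | zero => simpa using hg
  | succ n ih =>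
    rw [iteratedDeriv_succ]
    exact ih.deriv isOpen_ball

theorem VanishAllDeriv.exists_norm_le_infDist_pow {g : ℂ → ℂ} (hg : VanishAllDeriv E g)
    (hEc : IsClosed E) (hEne : E.Nonempty) (hE : E ⊆ closedBall 0 1) (N : ℕ) :
    ∃ C, ∀ z ∈ closedBall (0 : ℂ) 1, ‖g z‖ ≤ C * infDist z E ^ N := by
  obtain ⟨hgc, hgd, -, hgv⟩ := hg
  obtain ⟨G, hGc, hG, -⟩ := hgv N
  obtain ⟨M, hM⟩ := (isCompact_closedBall (0 : ℂ) 1).exists_bound_of_continuousOn hGc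
  have key : ∀ k n : ℕ, k + n = N → ∀ z ∈ ball (0 : ℂ) 1,
      ‖iteratedDeriv n g z‖ ≤ M * infDist z E ^ k := by
    intro k
    induction k with
    | zero =>
      intro n hn z hz
      rw [zero_add] at hn
      rw [hn, ← hG hz, pow_zero, mul_one]
      exact hM z (ball_subset_closedBall hz)
    | succ k ih =>
      intro n hn z hz
      obtain ⟨H, hHc, hHe, hH0⟩ := hgv n
      refine norm_le_infDist_pow_succ hEc hEne hE (hgd.iteratedDeriv_ball n) hHc hHe hH0
        (fun w hw => ?_) hz
      rw [← iteratedDeriv_succ]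
      exact ih (n + 1) (by omega) w hw
  refine ⟨M, fun z hz => ?_⟩
  rw [← closure_ball (0 : ℂ) one_ne_zero] at hz hgc
  refine le_on_closure (s := ball (0 : ℂ) 1) (f := fun z => ‖g z‖)
    (g := fun z => M * infDist z E ^ N) (fun w hw => ?_) hgc.norm ?_ hz
  · simpa using key N 0 (by omega) w hw
  · exact (continuous_const.mul ((continuous_infDist_pt E).pow N)).continuousOn

end Flatness

theorem le_re_harnack {q : ℂ → ℂ} (hq : Differentiable ℂ q) {r : ℝ} {w : ℂ} (hw : ‖w‖ < r)
    (hlow : ∀ z ∈ sphere (0 : ℂ) r, 0 ≤ (q z).re) :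
    (r - ‖w‖) / (r + ‖w‖) * (q 0).re ≤ (q w).re := by
  have hr : 0 < r := (norm_nonneg _).trans_lt hw
  have hw' : w ∈ ball (0 : ℂ) r := by simpa using hw
  have hP : ContinuousOn (poissonKernel 0 w) (sphere 0 r) := by
    have := continuousOn_herglotzRieszKernel_sphere hw'
    rw [abs_of_pos hr] at this
    rw [poissonKernel_eq_re_herglotzRieszKernel]
    exact continuous_re.comp_continuousOn this
  have hInt : ∀ P : ℂ → ℝ, ContinuousOn P (sphere 0 r) →
      CircleIntegrable (fun z => P z * (q z).re) 0 r := fun P hP =>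
    (hP.mul (continuous_re.comp hq.continuous).continuousOn).circleIntegrable hr.le
  have key : Real.circleAverage (fun z => poissonKernel 0 w z * (q z).re) 0 r = (q w).re := by
    rw [← (hq.diffContOnCl (s := ball 0 r)).circleAverage_poissonKernel_smul hw']
    have hci : CircleIntegrable (poissonKernel 0 w • q) 0 r :=
      (hP.smul hq.continuous.continuousOn).circleIntegrable hr.le
    have := Complex.reCLM.circleAverage_comp_comm hci
    simp only [reCLM_apply] at this
    rw [← this]
    congr 1
    ext z
    simp
  have key0 : Real.circleAverage (fun z => (r - ‖w‖) / (r + ‖w‖) * (q z).re) 0 r =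
      (r - ‖w‖) / (r + ‖w‖) * (q 0).re := by
    rw [← (hq.diffContOnCl (s := ball 0 |r|)).circleAverage]
    have hci : CircleIntegrable q 0 r := hq.continuous.continuousOn.circleIntegrable hr.le
    have := Complex.reCLM.circleAverage_comp_comm hci
    simp only [reCLM_apply] at this
    rw [← this]
    exact Real.circleAverage_fun_smul (a := (r - ‖w‖) / (r + ‖w‖)) (f := fun z => (q z).re)
  rw [← key, ← key0]
  refine Real.circleAverage_mono (hInt _ continuousOn_const) (hInt _ hP) fun z hz => ?_
  rw [abs_of_pos hr] at hz
  refine mul_le_mul_of_nonneg_right ?_ (hlow z hz)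
  have h1 := le_re_herglotzRieszKernel hz (w := w) (by simpa using hw)
  rw [poissonKernel_eq_re_herglotzRieszKernel]
  simpa [herglotzRieszKernel_def] using h1

/-- Boundary uniqueness: the boundary zero set of a nonzero function of the disc algebra is null. -/
theorem volume_circle_zeros_eq_zero {g : ℂ → ℂ} {E : Set ℂ} (hgc : ContinuousOn g (closedBall 0 1))
    (hgd : DifferentiableOn ℂ g (ball 0 1)) (hE : IsClosed E) (hE1 : E ⊆ sphere 0 1)
    (hgE : ∀ z ∈ E, g z = 0) {z₀ : ℂ} (hz₀ : z₀ ∈ ball (0 : ℂ) 1) (hg : g z₀ ≠ 0) :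
    volume {θ : ℝ | θ ∈ Ioc 0 (2 * Real.pi) ∧ circleMap 0 1 θ ∈ E} = 0 := by
  set S : Set ℝ := {θ : ℝ | θ ∈ Ioc 0 (2 * Real.pi) ∧ circleMap 0 1 θ ∈ E} with hS
  have hSm : MeasurableSet S :=
    measurableSet_Ioc.inter ((hE.preimage (continuous_circleMap 0 1)).measurableSet)
  have hSsub : S ⊆ Ioc 0 (2 * Real.pi) := fun θ h => h.1
  have hSfin : volume S ≠ ⊤ := measure_ne_top_of_subset hSsub measure_Ioc_lt_top.ne
  obtain ⟨K₀, hK₀⟩ := (isCompact_closedBall (0 : ℂ) 1).exists_bound_of_continuousOn hgc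
  obtain ⟨K, hK0, hK⟩ : ∃ K : ℝ, 0 < K ∧ ∀ z ∈ closedBall (0 : ℂ) 1, ‖g z‖ ≤ K :=
    ⟨max K₀ 1, by positivity, fun z hz => (hK₀ z hz).trans (le_max_left _ _)⟩
  have hz₀' : ‖z₀‖ < 1 := by simpa using hz₀
  set c := (1 - ‖z₀‖) / (1 + ‖z₀‖) with hc
  have hc0 : 0 < c := div_pos (by linarith) (by positivity)
  have main : ∀ L : ℝ, 0 ≤ L → c * ((2 * Real.pi)⁻¹ * (volume.real S * L)) ≤
      2 + Real.log K - Real.log ‖g z₀‖ := by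
    intro L hL
    set k : ℂ := ((Real.exp L / K : ℝ) : ℂ) with hk
    have hkn : ‖k‖ = Real.exp L / K := by
      rw [hk, norm_real, Real.norm_eq_abs, abs_of_pos (by positivity)]
    have hRc : ContinuousOn (fun z => k * g z) (closedBall 0 1) := continuousOn_const.mul hgc
    obtain ⟨p, hp, hpb⟩ := exists_entire_re_approx_log (R := fun z => k * g z) one_pos
      (hRc.mono sphere_subset_closedBall) (ε := 1) one_pos
    have hup : ∀ z ∈ sphere (0 : ℂ) 1, (p z).re ≤ 1 + L := by
      intro z hz
      rw [← Real.exp_le_exp, Real.exp_add]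
      refine (hpb z hz).2.1.trans ?_
      gcongr
      refine max_le (Real.one_le_exp hL) ?_
      rw [norm_mul, hkn, div_mul_eq_mul_div, div_le_iff₀ hK0]
      gcongr
      exact hK z (sphere_subset_closedBall hz)
    have hupE : ∀ z ∈ E, (p z).re ≤ 1 := by
      intro z hz
      have := (hpb z (hE1 hz)).2.1
      rw [hgE z hz] at this
      simpa using this
    let q : ℂ → ℂ := fun z => ((1 + L : ℝ) : ℂ) - p z
    have hqre : ∀ z, (q z).re = 1 + L - (p z).re := by
      intro z; simp only [q, sub_re, ofReal_re]
    have hq : Differentiable ℂ q := (differentiable_const _).sub hp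
    have hq1 := le_re_harnack hq hz₀' (fun z hz => by rw [hqre]; linarith [hup z hz])
    have hq0 : (2 * Real.pi)⁻¹ * (volume.real S * L) ≤ (q 0).re := by
      have hci : CircleIntegrable q 0 1 := hq.continuous.continuousOn.circleIntegrable zero_le_one
      have h1 := Complex.reCLM.circleAverage_comp_comm hci
      rw [(hq.diffContOnCl (s := ball 0 |1|)).circleAverage] at h1
      simp only [reCLM_apply] at h1
      have hcont : Continuous fun θ : ℝ => (q (circleMap 0 1 θ)).re :=
        continuous_re.comp (hq.continuous.comp (continuous_circleMap 0 1))
      rw [← h1, Real.circleAverage_def, smul_eq_mul]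
      refine mul_le_mul_of_nonneg_left ?_ (by positivity)
      rw [intervalIntegral.integral_of_le (by positivity)]
      have hInt : IntegrableOn (fun θ : ℝ => (q (circleMap 0 1 θ)).re) (Ioc 0 (2 * Real.pi)) :=
        (hcont.integrableOn_Icc).mono_set Ioc_subset_Icc_self
      calc volume.real S * L = ∫ θ in S, L := by rw [setIntegral_const, smul_eq_mul]
        _ ≤ ∫ θ in S, (q (circleMap 0 1 θ)).re := by
          refine setIntegral_mono_on (integrableOn_const hSfin) (hInt.mono_set hSsub) hSm
            fun θ hθ => ?_
          rw [hqre]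
          linarith [hupE _ hθ.2]
        _ ≤ ∫ θ in Ioc 0 (2 * Real.pi), (q (circleMap 0 1 θ)).re := by
          refine setIntegral_mono_set hInt ?_ hSsub.eventuallyLE
          refine ae_of_all _ fun θ => ?_
          simp only [Pi.zero_apply, hqre]
          linarith [hup _ (circleMap_mem_sphere 0 zero_le_one θ)]
    have hmax : ‖k * g z₀ * exp (-(p z₀))‖ ≤ Real.exp 1 := by
      refine Complex.norm_le_of_forall_mem_frontier_norm_le (isBounded_ball (x := (0 : ℂ)) (r := 1))
        (f := fun z => k * g z * exp (-(p z))) ⟨?_, ?_⟩ (fun z hz => ?_) (subset_closure hz₀)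
      · exact ((hgd.const_mul k).mul hp.neg.cexp.differentiableOn)
      · rw [closure_ball _ one_ne_zero]
        exact hRc.mul (hp.neg.cexp.continuous.continuousOn)
      · rw [frontier_ball _ one_ne_zero] at hz
        have := (le_max_right _ _).trans (hpb z hz).2.2
        rw [norm_mul, norm_exp, neg_re, Real.exp_neg, ← div_eq_mul_inv,
          div_le_iff₀ (Real.exp_pos _)]
        exact this
    have hgn : 0 < ‖g z₀‖ := norm_pos_iff.2 hg
    rw [norm_mul, norm_mul, norm_exp, hkn, neg_re] at hmax
    have h2 := Real.log_le_log (by positivity) hmax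
    rw [Real.log_mul (by positivity) (by positivity), Real.log_mul (by positivity) (by positivity),
      Real.log_div (by positivity) (by positivity), Real.log_exp, Real.log_exp, Real.log_exp] at h2
    have h3 := mul_le_mul_of_nonneg_left hq0 hc0.le
    rw [hqre z₀] at hq1
    linarith
  by_contra hne
  have hpos : 0 < volume.real S := ENNReal.toReal_pos hne hSfin
  set b := c * ((2 * Real.pi)⁻¹ * volume.real S) with hb
  have hb0 : 0 < b := by positivity
  set A := 2 + Real.log K - Real.log ‖g z₀‖ with hA
  have h1 := main ((|A| + 1) / b) (by positivity)
  have h2 : c * ((2 * Real.pi)⁻¹ * (volume.real S * ((|A| + 1) / b))) = |A| + 1 := by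
    have : c * ((2 * Real.pi)⁻¹ * (volume.real S * ((|A| + 1) / b))) = b * ((|A| + 1) / b) := by
      rw [hb]; ring
    rw [this, mul_div_cancel₀ _ hb0.ne']
  rw [h2] at h1
  linarith [le_abs_self A]

/-- A bounded family of entire functions has a holomorphic pointwise limit along an ultrafilter. -/
theorem exists_differentiableOn_ultralimit {ι : Type*} (𝓤 : Ultrafilter ι) {s : ι → ℂ → ℂ}
    {r : ι → ℝ} {M : ℝ} (hs : ∀ i, Differentiable ℂ (s i)) (hr : ∀ i, 0 < r i)
    (hr1 : Tendsto r 𝓤 (nhds 1)) (hsM : ∀ i, ∀ z ∈ sphere (0 : ℂ) (r i), ‖s i z‖ ≤ M) :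
    ∃ f : ℂ → ℂ, DifferentiableOn ℂ f (ball 0 1) ∧
      ∀ z ∈ ball (0 : ℂ) 1, Tendsto (fun i => s i z) 𝓤 (nhds (f z)) := by
  let a : ι → ℕ → ℂ := fun i k => (k.factorial : ℂ)⁻¹ * iteratedDeriv k (s i) 0
  have ha : ∀ i k, ‖a i k‖ ≤ M / r i ^ k := by
    intro i k
    have h1 := Complex.norm_iteratedDeriv_le_of_forall_mem_sphere_norm_le k (hr i)
      (hs i).diffContOnCl (hsM i)
    have hk : (0 : ℝ) < k.factorial := by positivity
    simp only [a, norm_mul, norm_inv, norm_natCast]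
    rw [inv_mul_le_iff₀ hk]
    refine h1.trans (le_of_eq ?_)
    ring
  have hsum : ∀ i z, s i z = ∑' k, a i k * z ^ k := by
    intro i z
    rw [← (Complex.hasSum_taylorSeries_of_entire (hs i) 0 z).tsum_eq]
    refine tsum_congr fun k => ?_
    simp only [a, sub_zero, smul_eq_mul]
    ring
  have hM : 0 ≤ M := by
    obtain ⟨i⟩ : Nonempty ι := (𝓤 : Filter ι).nonempty_of_neBot
    exact (norm_nonneg _).trans (hsM i (r i) (by simp [abs_of_pos (hr i)]))
  have hlim : ∀ k, ∃ b : ℂ, ‖b‖ ≤ M ∧ Tendsto (fun i => a i k) 𝓤 (nhds b) := by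
    intro k
    have hMr : Tendsto (fun i => M / r i ^ k) 𝓤 (nhds M) := by
      have h : Tendsto (fun i => M / r i ^ k) 𝓤 (nhds (M / 1 ^ k)) :=
        tendsto_const_nhds.div (hr1.pow k) (by simp)
      simpa using h
    have hev : ∀ᶠ i in 𝓤, a i k ∈ closedBall (0 : ℂ) (M + 1) := by
      filter_upwards [hMr.eventually (eventually_le_nhds (lt_add_one M))] with i hi
      rw [mem_closedBall_zero_iff]
      exact (ha i k).trans hi
    obtain ⟨b, -, hb⟩ := (isCompact_closedBall (0 : ℂ) (M + 1)).ultrafilter_le_nhds'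
      (𝓤.map fun i => a i k) hev
    have hb' : Tendsto (fun i => a i k) 𝓤 (nhds b) := hb
    exact ⟨b, le_of_tendsto_of_tendsto' hb'.norm hMr fun i => ha i k, hb'⟩
  choose b hbM hb using hlim
  refine ⟨fun z => ∑' k, b k * z ^ k, ?_, ?_⟩
  · intro z hz
    have hz1 : ‖z‖ < 1 := by simpa using hz
    obtain ⟨ρ, hρ, hρ1⟩ := exists_between hz1
    have hρ0 : 0 ≤ ρ := (norm_nonneg z).trans hρ.le
    have h : DifferentiableOn ℂ (fun z => ∑' k, b k * z ^ k) (ball 0 ρ) := by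
      refine differentiableOn_tsum_of_summable_norm
        ((summable_geometric_of_lt_one hρ0 hρ1).mul_left M) (fun k => by fun_prop) isOpen_ball
        fun k w hw => ?_
      rw [norm_mul, norm_pow]
      have : ‖w‖ ≤ ρ := by simpa using (mem_ball.1 hw).le
      gcongr
      exact hbM k
    exact (h.differentiableAt (isOpen_ball.mem_nhds (by simpa using hρ))).differentiableWithinAt
  · intro z hz
    have hz1 : ‖z‖ < 1 := by simpa using hz
    obtain ⟨ρ, hρ, hρ1⟩ := exists_between hz1
    have hρ0 : 0 < ρ := (norm_nonneg z).trans_lt hρ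
    simp only [hsum]
    refine tendsto_tsum_of_dominated_convergence
      ((summable_geometric_of_lt_one hρ0.le hρ1).mul_left M) (fun k => (hb k).mul_const _) ?_
    have hq : ‖z‖ / ρ < 1 := (div_lt_one hρ0).2 hρ
    filter_upwards [hr1.eventually (eventually_ge_nhds hq)] with i hi k
    rw [norm_mul, norm_pow]
    calc ‖a i k‖ * ‖z‖ ^ k ≤ M / r i ^ k * ‖z‖ ^ k := by gcongr; exact ha i k
      _ = M * (‖z‖ / r i) ^ k := by rw [div_pow]; ring
      _ ≤ M * ρ ^ k := by
        have h1 := hr i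
        gcongr
        rw [div_le_iff₀ h1]
        rwa [div_le_iff₀ hρ0, mul_comm] at hi

section Outer

variable {V : Type*} [NormedAddCommGroup V] [NormedSpace ℂ V]

/-- A vector-valued holomorphic function `ψ` whose product with some bounded holomorphic `f₀` is
bounded has a scalar minorant `s` of `1 / max 1 ‖ψ‖` that is unimodular at the boundary points
near which `‖ψ‖ ≤ 1`. -/
theorem exists_holomorphic_minorant {ψ : ℂ → V} (hψ : DifferentiableOn ℂ ψ (ball 0 1))
    {f₀ : ℂ → ℂ} {C₀ : ℝ} (hf₀ : DifferentiableOn ℂ f₀ (ball 0 1)) (hf₀0 : f₀ 0 ≠ 0)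
    (hf₀C : ∀ z ∈ ball (0 : ℂ) 1, ‖f₀ z‖ ≤ C₀) (hf₀ψ : ∀ z ∈ ball (0 : ℂ) 1, ‖f₀ z • ψ z‖ ≤ C₀) :
    ∃ s : ℂ → ℂ, DifferentiableOn ℂ s (ball 0 1) ∧ (∀ z ∈ ball (0 : ℂ) 1, ‖s z‖ ≤ 1) ∧
      (∀ z ∈ ball (0 : ℂ) 1, ‖s z • ψ z‖ ≤ 1) ∧
      (∀ (f : ℂ → ℂ) (C : ℝ), DifferentiableOn ℂ f (ball 0 1) →
        (∀ z ∈ ball (0 : ℂ) 1, ‖f z‖ ≤ C) → (∀ z ∈ ball (0 : ℂ) 1, ‖f z • ψ z‖ ≤ C) →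
        ∀ z ∈ ball (0 : ℂ) 1, ‖f z‖ ≤ C * ‖s z‖) ∧
      ∀ ζ ∈ sphere (0 : ℂ) 1, (∃ δ > 0, ∀ z ∈ ball (0 : ℂ) 1, ‖z - ζ‖ < δ → ‖ψ z‖ ≤ 1) →
        Tendsto (fun ρ : ℝ => ‖s (ρ * ζ)‖) (nhdsWithin 1 (Iio 1)) (nhds 1) := by
  let ε : ℕ → ℝ := fun n => 1 / ((n : ℝ) + 1)
  have hε0 : ∀ n, 0 < ε n := fun n => by positivity
  have hεt : Tendsto ε atTop (nhds 0) := tendsto_one_div_add_atTop_nhds_zero_nat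
  have hε1 : ∀ n, ε n ≤ 1 := fun n => by
    simp only [ε]
    rw [div_le_one (by positivity)]
    linarith [(Nat.cast_nonneg n : (0 : ℝ) ≤ n)]
  let r : ℕ → ℝ := fun n => 1 - ε n / 2
  have hr0 : ∀ n, 0 < r n := fun n => by have := hε1 n; simp only [r]; linarith
  have hr1 : ∀ n, r n < 1 := fun n => by have := hε0 n; simp only [r]; linarith
  have hrt : Tendsto r atTop (nhds 1) := by
    simpa using (tendsto_const_nhds (x := (1 : ℝ))).sub (hεt.div_const 2)
  have hcb : ∀ n, closedBall (0 : ℂ) (r n) ⊆ ball 0 1 := fun n => closedBall_subset_ball (hr1 n)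
  have hsb : ∀ n, sphere (0 : ℂ) (r n) ⊆ ball 0 1 := fun n => sphere_subset_closedBall.trans (hcb n)
  choose p hp hpb using fun n => exists_entire_re_approx_log (R := ψ) (hr0 n)
    (hψ.continuousOn.mono (hsb n)) (hε0 n)
  let s : ℕ → ℂ → ℂ := fun n z => exp (-(p n z))
  have hs : ∀ n, Differentiable ℂ (s n) := fun n => (hp n).neg.cexp
  have hsn : ∀ n z, ‖s n z‖ = Real.exp (-(p n z).re) := fun n z => by simp [s, norm_exp]
  have hs1 : ∀ n, ∀ z ∈ sphere (0 : ℂ) (r n), ‖s n z‖ ≤ Real.exp (ε n) := fun n z hz => by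
    rw [hsn]
    exact Real.exp_le_exp.2 (by linarith [(hpb n z hz).1])
  have hs2 : ∀ n, ∀ z ∈ closedBall (0 : ℂ) (r n), ‖s n z‖ ≤ Real.exp (ε n) := fun n z hz =>
    norm_le_of_sphere_le (hs n).differentiableOn (hr0 n) (hs1 n) hz
  have hs3 : ∀ n, ∀ z ∈ closedBall (0 : ℂ) (r n), ‖s n z • ψ z‖ ≤ Real.exp (ε n) := fun n z hz =>
    norm_le_of_sphere_le (F := fun z => s n z • ψ z)
      ((hs n).differentiableOn.smul (hψ.mono (hcb n))) (hr0 n) (fun w hw => by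
        have h1 := (le_max_right _ _).trans (hpb n w hw).2.2
        rw [norm_smul, hsn, Real.exp_neg, inv_mul_le_iff₀ (Real.exp_pos _), mul_comm]
        exact h1) hz
  have hs4 : ∀ n (f : ℂ → ℂ) (C : ℝ), DifferentiableOn ℂ f (ball 0 1) →
      (∀ z ∈ ball (0 : ℂ) 1, ‖f z‖ ≤ C) → (∀ z ∈ ball (0 : ℂ) 1, ‖f z • ψ z‖ ≤ C) →
      ∀ z ∈ closedBall (0 : ℂ) (r n), ‖f z‖ ≤ Real.exp (ε n) * C * ‖s n z‖ := by
    intro n f C hf hfC hfψ z hz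
    have h1 := norm_le_of_sphere_le (F := fun z => f z * exp (p n z)) (M := Real.exp (ε n) * C)
      ((hf.mono (hcb n)).mul (hp n).cexp.differentiableOn) (hr0 n) (fun w hw => by
        have h1 := (hpb n w hw).2.1
        rw [norm_mul, norm_exp]
        calc ‖f w‖ * Real.exp (p n w).re ≤ ‖f w‖ * (Real.exp (ε n) * max 1 ‖ψ w‖) := by gcongr
          _ = Real.exp (ε n) * max ‖f w‖ (‖f w‖ * ‖ψ w‖) := by
            rw [mul_left_comm, mul_max_of_nonneg _ _ (norm_nonneg _), mul_one]
          _ ≤ _ := by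
            rw [← norm_smul]
            gcongr
            exact max_le (hfC w (hsb n hw)) (hfψ w (hsb n hw))) hz
    rw [norm_mul, norm_exp] at h1
    rw [hsn, Real.exp_neg, ← div_eq_mul_inv, le_div_iff₀ (Real.exp_pos _)]
    exact h1
  let 𝓤 : Ultrafilter ℕ := hyperfilter ℕ
  have h𝓤 : (𝓤 : Filter ℕ) ≤ atTop := Nat.hyperfilter_le_atTop
  obtain ⟨σ, hσd, hσ⟩ := exists_differentiableOn_ultralimit 𝓤 hs hr0 (hrt.mono_left h𝓤)
    (M := Real.exp 1) (fun n z hz => (hs1 n z hz).trans (Real.exp_le_exp.2 (hε1 n)))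
  have hexpε : Tendsto (fun n => Real.exp (ε n)) 𝓤 (nhds 1) := by
    have := (Real.continuous_exp.tendsto 0).comp (hεt.mono_left h𝓤)
    rwa [Real.exp_zero] at this
  have hev : ∀ z ∈ ball (0 : ℂ) 1, ∀ᶠ n in (𝓤 : Filter ℕ), ‖z‖ < r n := by
    intro z hz
    exact (hrt.mono_left h𝓤).eventually (eventually_gt_nhds (by simpa using hz))
  have hσ1 : ∀ z ∈ ball (0 : ℂ) 1, ‖σ z‖ ≤ 1 := fun z hz => by
    refine le_of_tendsto_of_tendsto (hσ z hz).norm hexpε ?_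
    filter_upwards [hev z hz] with n hn
    exact hs2 n z (by simpa using hn.le)
  refine ⟨σ, hσd, hσ1, fun z hz => ?_, fun f C hf hfC hfψ z hz => ?_, fun ζ hζ hδ => ?_⟩
  · refine le_of_tendsto_of_tendsto ((hσ z hz).smul_const (ψ z)).norm hexpε ?_
    filter_upwards [hev z hz] with n hn
    exact hs3 n z (by simpa using hn.le)
  · have h1 : Tendsto (fun n => Real.exp (ε n) * C * ‖s n z‖) 𝓤 (nhds (1 * C * ‖σ z‖)) :=
      (hexpε.mul_const C).mul (hσ z hz).norm
    rw [one_mul] at h1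
    refine le_of_tendsto_of_tendsto tendsto_const_nhds h1 ?_
    filter_upwards [hev z hz] with n hn
    exact hs4 n f C hf hfC hfψ z (by simpa using hn.le)
  · obtain ⟨δ, hδ0, hδ⟩ := hδ
    have hζ1 : ‖ζ‖ = 1 := by simpa using hζ
    -- the values of `Re p` at the origin are bounded
    obtain ⟨P, hP0, hP⟩ : ∃ P : ℝ, 0 ≤ P ∧ ∀ n, (p n 0).re ≤ P := by
      have hf0 : 0 < ‖f₀ 0‖ := norm_pos_iff.2 hf₀0
      have h0 : (0 : ℂ) ∈ ball (0 : ℂ) 1 := by simp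
      have hC0 : 0 < C₀ := hf0.trans_le (hf₀C 0 h0)
      refine ⟨max 0 (1 + Real.log (C₀ / ‖f₀ 0‖)), le_max_left _ _, fun n => le_max_of_le_right ?_⟩
      have h1 := hs4 n f₀ C₀ hf₀ hf₀C hf₀ψ 0 (by simpa using (hr0 n).le)
      rw [hsn, Real.exp_neg, ← div_eq_mul_inv, le_div_iff₀ (Real.exp_pos _)] at h1
      rw [← Real.exp_le_exp, Real.exp_add, Real.exp_log (by positivity), ← mul_div_assoc,
        le_div_iff₀ hf0, mul_comm]
      refine h1.trans ?_
      gcongr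
      exact hε1 n
    have hlow : ∀ ρ : ℝ, 0 < ρ → 1 - δ / 2 < ρ → ρ < 1 →
        Real.exp (-((1 - ρ ^ 2) / (δ / 2) ^ 2 * P)) ≤ ‖σ (ρ * ζ)‖ := by
      intro ρ hρ0 hρδ hρ1
      have hwn : ‖(ρ : ℂ) * ζ‖ = ρ := by
        rw [norm_mul, hζ1, mul_one, norm_real, Real.norm_eq_abs, abs_of_pos hρ0]
      have hwb : (ρ : ℂ) * ζ ∈ ball (0 : ℂ) 1 := by rw [mem_ball_zero_iff, hwn]; exact hρ1
      have hwζ : ‖(ρ : ℂ) * ζ - ζ‖ = 1 - ρ := by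
        rw [show (ρ : ℂ) * ζ - ζ = ((ρ - 1 : ℝ) : ℂ) * ζ by push_cast; ring, norm_mul, hζ1, mul_one,
          norm_real, Real.norm_eq_abs, abs_of_neg (by linarith)]
        ring
      have hlim : Tendsto (fun n => Real.exp (-(ε n + (r n ^ 2 - ρ ^ 2) / (δ / 2) ^ 2 * (P + ε n)))) 𝓤
          (nhds (Real.exp (-(0 + (1 ^ 2 - ρ ^ 2) / (δ / 2) ^ 2 * (P + 0))))) := by
        have h1 := hεt.mono_left h𝓤
        have h2 := hrt.mono_left h𝓤
        exact (Real.continuous_exp.tendsto _).comp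
          (h1.add ((((h2.pow 2).sub_const _).div_const _).mul (h1.const_add P))).neg
      rw [zero_add, add_zero, one_pow] at hlim
      refine le_of_tendsto_of_tendsto hlim (hσ _ hwb).norm ?_
      filter_upwards [hev _ hwb] with n hn
      rw [hsn]
      refine Real.exp_le_exp.2 (neg_le_neg ?_)
      rw [hwn] at hn
      have hM : 0 ≤ (r n ^ 2 - ρ ^ 2) / (δ / 2) ^ 2 := by
        apply div_nonneg _ (by positivity)
        nlinarith
      refine (re_le_of_poissonKernel (hp n) (r := r n) (w := ρ * ζ) (by rwa [hwn]) (hε0 n).le hM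
        (fun z hz => (hpb n z hz).1) fun z hz => ?_).trans ?_
      · by_cases hzδ : ‖z - ζ‖ < δ
        · left
          have h1 := (hpb n z hz).2.1
          rw [max_eq_left (hδ z (hsb n hz) hzδ), mul_one] at h1
          exact Real.exp_le_exp.1 h1
        · right
          have hzn : ‖z‖ = r n := by simpa using hz
          have h1 : δ / 2 ≤ ‖z - ρ * ζ‖ := by
            have := norm_sub_le_norm_sub_add_norm_sub z (ρ * ζ) ζ
            rw [hwζ] at this
            linarith
          rw [poissonKernel_def, sub_zero, sub_zero, hzn, hwn]
          apply div_le_div_of_nonneg_left _ (by positivity) (by gcongr)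
          nlinarith
      · gcongr
        exact hP n
    have hlim : Tendsto (fun ρ : ℝ => Real.exp (-((1 - ρ ^ 2) / (δ / 2) ^ 2 * P)))
        (nhdsWithin 1 (Iio 1)) (nhds 1) := by
      have hc : Continuous fun ρ : ℝ => Real.exp (-((1 - ρ ^ 2) / (δ / 2) ^ 2 * P)) := by fun_prop
      have := hc.tendsto 1
      simp only [one_pow, sub_self, zero_div, zero_mul, neg_zero, Real.exp_zero] at this
      exact this.mono_left nhdsWithin_le_nhds
    have hev1 : ∀ᶠ ρ : ℝ in nhdsWithin 1 (Iio 1), ρ < 1 := self_mem_nhdsWithin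
    have hev2 : ∀ᶠ ρ : ℝ in nhdsWithin 1 (Iio 1), 0 < ρ :=
      nhdsWithin_le_nhds (eventually_gt_nhds one_pos)
    have hev3 : ∀ᶠ ρ : ℝ in nhdsWithin 1 (Iio 1), 1 - δ / 2 < ρ :=
      nhdsWithin_le_nhds (eventually_gt_nhds (by linarith))
    refine tendsto_of_tendsto_of_tendsto_of_le_of_le' hlim tendsto_const_nhds ?_ ?_
    · filter_upwards [hev1, hev2, hev3] with ρ h1 h2 h3
      exact hlow ρ h2 h3 h1
    · filter_upwards [hev1, hev2] with ρ h1 h2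
      refine hσ1 _ ?_
      rw [mem_ball_zero_iff, norm_mul, hζ1, mul_one, norm_real, Real.norm_eq_abs, abs_of_pos h2]
      exact h1

end Outer

theorem hasSum_circleIntegral_of_summable {V : Type*} [NormedAddCommGroup V] [NormedSpace ℂ V]
    {F : ℕ → ℂ → V} {f : ℂ → V} {u : ℕ → ℝ} {c : ℂ} {R : ℝ} (hR : 0 ≤ R)
    (hF : ∀ n, ContinuousOn (F n) (sphere c R)) (hu : Summable u)
    (hFu : ∀ n, ∀ z ∈ sphere c R, ‖F n z‖ ≤ u n)
    (hf : ∀ z ∈ sphere c R, HasSum (fun n => F n z) (f z)) :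
    HasSum (fun n => ∮ z in C(c, R), F n z) (∮ z in C(c, R), f z) := by
  refine intervalIntegral.hasSum_integral_of_dominated_convergence (fun n _ => R * u n) (fun n => ?_)
    (fun n => ?_) (Eventually.of_forall fun _ _ => hu.mul_left R) ?_ ?_
  · have h := (hF n).circleIntegrable hR
    exact (intervalIntegrable_iff.1 h.out).aestronglyMeasurable
  · refine Eventually.of_forall fun θ _ => ?_
    rw [norm_smul]
    have h1 : ‖deriv (circleMap c R) θ‖ = R := by simp [abs_of_nonneg hR]
    rw [h1]
    gcongr
    exact hFu n _ (circleMap_mem_sphere c hR θ)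
  · exact intervalIntegrable_const
  · exact Eventually.of_forall fun θ _ => (hf _ (circleMap_mem_sphere c hR θ)).const_smul _

section Contour

variable {B : Type*} [NormedRing B] [NormedAlgebra ℂ B] [CompleteSpace B] {T : B}

theorem circleIntegral_pow_smul_resolvent (hT : ∀ n, ‖T ^ n‖ ≤ 1) {ρ : ℝ} (hρ : 1 < ρ) (k : ℕ) :
    ∮ z in C(0, ρ), z ^ k • resolvent T z = (2 * Real.pi * I : ℂ) • T ^ k := by
  have hρ0 : 0 < ρ := by linarith
  have hz0 : ∀ z ∈ sphere (0 : ℂ) ρ, z ≠ 0 := fun z hz h => by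
    rw [h] at hz
    simp at hz
    linarith
  have hzn : ∀ z ∈ sphere (0 : ℂ) ρ, ‖z‖ = ρ := fun z hz => by simpa using hz
  have h1 : HasSum (fun n => ∮ z in C(0, ρ), (z ^ k * (z ^ (n + 1))⁻¹) • T ^ n)
      (∮ z in C(0, ρ), z ^ k • resolvent T z) := by
    refine hasSum_circleIntegral_of_summable (u := fun n => ρ ^ k * ρ⁻¹ * ρ⁻¹ ^ n) hρ0.le
      (fun n => ?_) ?_ (fun n z hz => ?_) fun z hz => ?_
    · refine ContinuousOn.smul ?_ continuousOn_const
      refine (continuousOn_id.pow k).mul ((continuousOn_id.pow (n + 1)).inv₀ fun z hz => ?_)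
      exact pow_ne_zero _ (hz0 z hz)
    · exact (summable_geometric_of_lt_one (by positivity) (inv_lt_one_of_one_lt₀ hρ)).mul_left _
    · rw [norm_smul, norm_mul, norm_inv, norm_pow, norm_pow, hzn z hz]
      calc ρ ^ k * (ρ ^ (n + 1))⁻¹ * ‖T ^ n‖ ≤ ρ ^ k * (ρ ^ (n + 1))⁻¹ * 1 := by
            gcongr; exact hT n
        _ = _ := by rw [pow_succ, mul_inv, inv_pow]; ring
    · have := (hasSum_resolvent hT (l := z) (by rw [hzn z hz]; exact hρ)).const_smul (z ^ k)
      simpa [smul_smul] using this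
  have h2 : ∀ n, ∮ z in C(0, ρ), (z ^ k * (z ^ (n + 1))⁻¹) • T ^ n =
      if n = k then (2 * Real.pi * I : ℂ) • T ^ k else 0 := by
    intro n
    rw [circleIntegral.integral_smul_const]
    have hzp : ∀ z ∈ sphere (0 : ℂ) ρ, z ^ k * (z ^ (n + 1))⁻¹ = (z - 0) ^ ((k : ℤ) - (n + 1 : ℕ)) := by
      intro z hz
      rw [sub_zero, zpow_sub₀ (hz0 z hz), zpow_natCast, zpow_natCast, div_eq_mul_inv]
    rw [circleIntegral.integral_congr hρ0.le hzp]
    split_ifs with h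
    · subst h
      rw [show (n : ℤ) - (n + 1 : ℕ) = -1 by push_cast; ring]
      simp only [zpow_neg_one]
      rw [circleIntegral.integral_sub_center_inv 0 hρ0.ne']
    · rw [circleIntegral.integral_sub_zpow_of_ne (by push_cast; omega), zero_smul]
  rw [funext h2] at h1
  exact h1.unique (hasSum_ite_eq k _)

theorem circleIntegral_smul_resolvent (hT : ∀ n, ‖T ^ n‖ ≤ 1) {g : ℂ → ℂ} {a : ℕ → ℂ}
    (hg : IsAPlusCoeff g a) {ρ : ℝ} (hρ : 1 < ρ) :
    ∮ z in C(0, ρ), g (z / ρ ^ 2) • resolvent T z =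
      (2 * Real.pi * I : ℂ) • ∑' k, (a k * ((ρ : ℂ) ^ 2)⁻¹ ^ k) • T ^ k := by
  have hρ0 : 0 < ρ := by linarith
  have hzn : ∀ z ∈ sphere (0 : ℂ) ρ, ‖z‖ = ρ := fun z hz => by simpa using hz
  have hρn : ‖(ρ : ℂ)‖ = ρ := by rw [norm_real, Real.norm_eq_abs, abs_of_pos hρ0]
  have h1 : HasSum (fun k => ∮ z in C(0, ρ), (a k * ((ρ : ℂ) ^ 2)⁻¹ ^ k) • (z ^ k • resolvent T z))
      (∮ z in C(0, ρ), g (z / ρ ^ 2) • resolvent T z) := by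
    refine hasSum_circleIntegral_of_summable (u := fun k => ‖a k‖ * (1 / (ρ - 1))) hρ0.le
      (fun k => ?_) (hg.1.mul_right _) (fun k z hz => ?_) fun z hz => ?_
    · refine continuousOn_const.smul ((continuousOn_id.pow k).smul ?_)
      refine differentiableOn_resolvent.continuousOn.mono fun z hz => ?_
      exact mem_resolventSet_of_one_lt hT (by rw [hzn z hz]; exact hρ)
    · have h2 := norm_resolvent_le_of_one_lt hT (l := z) (by rw [hzn z hz]; exact hρ)
      rw [hzn z hz] at h2
      rw [norm_smul, norm_smul, norm_mul, norm_pow, norm_pow, norm_inv, norm_pow, hρn, hzn z hz]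
      have h3 : (ρ ^ 2)⁻¹ ^ k * ρ ^ k ≤ 1 := by
        rw [← mul_pow]
        refine pow_le_one₀ (by positivity) ?_
        rw [inv_mul_le_iff₀ (by positivity)]
        nlinarith
      calc ‖a k‖ * (ρ ^ 2)⁻¹ ^ k * (ρ ^ k * ‖resolvent T z‖)
          = ‖a k‖ * (((ρ ^ 2)⁻¹ ^ k * ρ ^ k) * ‖resolvent T z‖) := by ring
        _ ≤ ‖a k‖ * (1 * (1 / (ρ - 1))) := by gcongr
        _ = _ := by rw [one_mul]
    · have hmem : z / ρ ^ 2 ∈ closedBall (0 : ℂ) 1 := by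
        rw [mem_closedBall_zero_iff, norm_div, norm_pow, hρn, hzn z hz, div_le_one (by positivity)]
        nlinarith
      have h2 := (hg.2 _ hmem).smul_const (resolvent T z)
      refine h2.congr_fun fun k => ?_
      rw [smul_smul, div_pow, inv_pow, div_eq_inv_mul, mul_assoc]
  have h2 : ∀ k, ∮ z in C(0, ρ), (a k * ((ρ : ℂ) ^ 2)⁻¹ ^ k) • (z ^ k • resolvent T z) =
      (2 * Real.pi * I : ℂ) • ((a k * ((ρ : ℂ) ^ 2)⁻¹ ^ k) • T ^ k) := by
    intro k
    rw [circleIntegral.integral_smul, circleIntegral_pow_smul_resolvent hT hρ, smul_comm]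
  rw [funext h2] at h1
  rw [← h1.tsum_eq, tsum_const_smul'']

/-- If the vector-valued boundary values of `g • resolvent T` agree from both sides of the
circle, in a dominated way, then `g(T) = 0`. -/
theorem tsum_smul_pow_eq_zero {E : Set ℂ} (hT : ∀ n, ‖T ^ n‖ ≤ 1) (hEne : E.Nonempty)
    (hE : E ⊆ sphere 0 1) (hE0 : volume {θ : ℝ | θ ∈ Ioc 0 (2 * Real.pi) ∧ circleMap 0 1 θ ∈ E} = 0)
    (hres : ∀ l ∉ E, l ∈ resolventSet ℂ T) {g : ℂ → ℂ} {a : ℕ → ℂ} (hg : IsAPlusCoeff g a)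
    (hgc : ContinuousOn g (closedBall 0 1)) (hgd : DifferentiableOn ℂ g (ball 0 1))
    {C₁ C₂ M : ℝ} (hgC : ∀ z ∈ closedBall (0 : ℂ) 1, ‖g z‖ ≤ C₁ * infDist z E ^ 3)
    (hR : ∀ l ∉ E, 1 ≤ ‖l‖ → ‖l‖ ≤ 2 → ‖resolvent T l‖ * infDist l E ^ 3 ≤ C₂)
    (hM : ∀ z ∈ ball (0 : ℂ) 1, ‖g z • resolvent T z‖ ≤ M) :
    ∑' n, a n • T ^ n = 0 := by
  have hRc : ∀ l ∉ E, ContinuousAt (resolvent T) l := fun l hl =>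
    (differentiableOn_resolvent.differentiableAt
      ((spectrum.isOpen_resolventSet T).mem_nhds (hres l hl))).continuousAt
  have hae : ∀ᵐ θ : ℝ, θ ∈ uIoc 0 (2 * Real.pi) → circleMap 0 1 θ ∉ E := by
    rw [ae_iff]
    refine measure_mono_null (fun θ hθ => ?_) hE0
    rw [uIoc_of_le (by positivity)] at hθ
    simp only [mem_ofPred_eq, Classical.not_imp, not_not] at hθ
    exact hθ
  have hcm : ∀ (ρ θ : ℝ), circleMap 0 ρ θ = ρ * circleMap 0 1 θ := by
    intro ρ θ; simp [circleMap]
  have hcn : ∀ θ : ℝ, ‖circleMap 0 1 θ‖ = 1 := by intro θ; simp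
  set ψ : ℂ → B := fun z => g z • resolvent T z with hψ
  let L : B := ∮ z in C(0, 1), ψ z
  let ε : ℕ → ℝ := fun n => 1 / ((n : ℝ) + 1)
  have hε0 : ∀ n, 0 < ε n := fun n => by positivity
  have hεt : Tendsto ε atTop (nhds 0) := tendsto_one_div_add_atTop_nhds_zero_nat
  have hε1 : ∀ n, ε n ≤ 1 := fun n => by
    simp only [ε]
    rw [div_le_one (by positivity)]
    linarith [(Nat.cast_nonneg n : (0 : ℝ) ≤ n)]
  let r : ℕ → ℝ := fun n => 1 - ε n / 2
  have hr0 : ∀ n, 0 < r n := fun n => by have := hε1 n; simp only [r]; linarith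
  have hr1 : ∀ n, r n < 1 := fun n => by have := hε0 n; simp only [r]; linarith
  have hrt : Tendsto r atTop (nhds 1) := by
    simpa using (tendsto_const_nhds (x := (1 : ℝ))).sub (hεt.div_const 2)
  let ρ : ℕ → ℝ := fun n => 1 + ε n
  have hρ1 : ∀ n, 1 < ρ n := fun n => by have := hε0 n; simp only [ρ]; linarith
  have hρ2 : ∀ n, ρ n ≤ 2 := fun n => by have := hε1 n; simp only [ρ]; linarith
  have hρt : Tendsto ρ atTop (nhds 1) := by
    simpa using (tendsto_const_nhds (x := (1 : ℝ))).add hεt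
  have hbE : ∀ z ∈ ball (0 : ℂ) 1, z ∉ E := fun z hz h => by
    have h1 : ‖z‖ = 1 := by simpa using hE h
    have h2 : ‖z‖ < 1 := by simpa using hz
    linarith
  have hψd : DifferentiableOn ℂ ψ (ball 0 1) :=
    hgd.smul (differentiableOn_resolvent.mono fun z hz => hres z (hbE z hz))
  have hct : ∀ (ϱ : ℕ → ℝ) (θ : ℝ), Tendsto ϱ atTop (nhds 1) →
      Tendsto (fun n => circleMap 0 (ϱ n) θ) atTop (nhds (circleMap 0 1 θ)) := by
    intro ϱ θ hϱ
    rw [show (fun n => circleMap 0 (ϱ n) θ) = fun n => (ϱ n : ℂ) * circleMap 0 1 θ from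
      funext fun n => hcm _ _]
    have h1 : Tendsto (fun n => (ϱ n : ℂ)) atTop (nhds ((1 : ℝ) : ℂ)) :=
      (continuous_ofReal.tendsto 1).comp hϱ
    simpa using h1.mul_const (circleMap 0 1 θ)
  have hgt : ∀ (ϱ : ℕ → ℝ) (θ : ℝ), Tendsto ϱ atTop (nhds 1) → (∀ n, 0 < ϱ n) → (∀ n, ϱ n ≤ 1) →
      Tendsto (fun n => g (circleMap 0 (ϱ n) θ)) atTop (nhds (g (circleMap 0 1 θ))) := by
    intro ϱ θ hϱ h0 h1
    have h2 : ContinuousWithinAt g (closedBall 0 1) (circleMap 0 1 θ) :=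
      hgc _ (by rw [mem_closedBall_zero_iff, hcn])
    refine h2.tendsto.comp (tendsto_nhdsWithin_iff.2 ⟨hct ϱ θ hϱ, Eventually.of_forall fun n => ?_⟩)
    rw [hcm, mem_closedBall_zero_iff, norm_mul, hcn, mul_one, norm_real, Real.norm_eq_abs,
      abs_of_pos (h0 n)]
    exact h1 n
  -- integration over the circles inside the disc
  have hin : L = 0 := by
    have h1 : Tendsto (fun n => ∮ z in C(0, r n), ψ z) atTop (nhds L) := by
      refine intervalIntegral.tendsto_integral_filter_of_dominated_convergence (fun _ => M)
        (Eventually.of_forall fun n => ?_) (Eventually.of_forall fun n => ?_)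
        intervalIntegrable_const ?_
      · have h2 : CircleIntegrable ψ 0 (r n) := (hψd.continuousOn.mono
          ((sphere_subset_closedBall).trans (closedBall_subset_ball (hr1 n)))).circleIntegrable
            (hr0 n).le
        exact (intervalIntegrable_iff.1 h2.out).aestronglyMeasurable
      · refine Eventually.of_forall fun θ _ => ?_
        have h3 : ‖deriv (circleMap 0 (r n)) θ‖ = r n := by simp [abs_of_pos (hr0 n)]
        have h4 := hM (circleMap 0 (r n) θ) (by
          rw [mem_ball_zero_iff, norm_circleMap_zero, abs_of_pos (hr0 n)]; exact hr1 n)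
        rw [norm_smul, h3]
        calc r n * ‖ψ (circleMap 0 (r n) θ)‖ ≤ 1 * M := by
              gcongr
              exact (hr1 n).le
          _ = M := one_mul M
      · filter_upwards [hae] with θ hθ hmem
        simp only [deriv_circleMap]
        exact ((hct r θ hrt).mul_const I).smul ((hgt r θ hrt hr0 fun n => (hr1 n).le).smul
          ((hRc _ (hθ hmem)).tendsto.comp (hct r θ hrt)))
    have h2 : ∀ n, ∮ z in C(0, r n), ψ z = 0 := by
      intro n
      refine DiffContOnCl.circleIntegral_eq_zero (hr0 n).le (DifferentiableOn.diffContOnCl ?_)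
      rw [closure_ball _ (hr0 n).ne']
      exact hψd.mono (closedBall_subset_ball (hr1 n))
    rw [funext h2] at h1
    exact (tendsto_const_nhds_iff.1 h1).symm
  have hE2 : ∀ n (θ : ℝ), infDist (circleMap 0 (ρ n)⁻¹ θ) E ≤ infDist (circleMap 0 (ρ n) θ) E := by
    intro n θ
    rw [le_infDist hEne]
    intro e he
    refine (infDist_le_dist_of_mem he).trans ?_
    rw [dist_eq_norm, dist_eq_norm, hcm _ θ, hcm (ρ n) θ]
    have he1 : ‖e‖ = 1 := by simpa using hE he
    have hu1 := hcn θ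
    set u := circleMap 0 1 θ
    have hρ := hρ1 n
    have hρ0 : 0 < ρ n := by linarith
    have hρc : (ρ n : ℂ) ≠ 0 := by exact_mod_cast hρ0.ne'
    have e1 : (((ρ n)⁻¹ : ℝ) : ℂ) * u - e = (((ρ n)⁻¹ : ℝ) : ℂ) * (u - ρ n * e) := by
      push_cast; field_simp
    have e2 : ‖u - ρ n * e‖ = ‖ρ n * u - e‖ := by
      rw [← sq_eq_sq₀ (norm_nonneg _) (norm_nonneg _), Complex.sq_norm, Complex.sq_norm,
        normSq_apply, normSq_apply]
      have h1 : u.re * u.re + u.im * u.im = 1 := by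
        rw [← normSq_apply, normSq_eq_norm_sq, hu1, one_pow]
      have h2 : e.re * e.re + e.im * e.im = 1 := by
        rw [← normSq_apply, normSq_eq_norm_sq, he1, one_pow]
      simp only [sub_re, sub_im, re_ofReal_mul, im_ofReal_mul]
      linear_combination (1 - ρ n ^ 2) * h1 + (ρ n ^ 2 - 1) * h2
    rw [e1, norm_mul, e2, norm_real, Real.norm_eq_abs, abs_of_pos (inv_pos.2 hρ0)]
    exact mul_le_of_le_one_left (norm_nonneg _) (inv_le_one_of_one_le₀ hρ.le)
  have hC1 : 0 ≤ C₁ := by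
    by_contra! hneg
    have h0 := hgC 0 (by simp)
    obtain ⟨e, he⟩ := hEne
    have h1 : infDist (0 : ℂ) E = 1 := by
      refine le_antisymm ?_ ?_
      · refine (infDist_le_dist_of_mem he).trans (le_of_eq ?_)
        rw [dist_zero_left]
        simpa using hE he
      · rw [le_infDist ⟨e, he⟩]
        intro y hy
        rw [dist_zero_left]
        exact le_of_eq (by simpa using (hE hy).symm)
    rw [h1] at h0
    linarith [norm_nonneg (g 0)]
  -- integration over the circles outside the disc
  have hout : Tendsto (fun n => ∮ z in C(0, ρ n), g (z / (ρ n) ^ 2) • resolvent T z) atTop (nhds L) := by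
    have hdiv : ∀ n (θ : ℝ), circleMap 0 (ρ n) θ / (ρ n : ℂ) ^ 2 = circleMap 0 (ρ n)⁻¹ θ := by
      intro n θ
      have hρ0 : (ρ n : ℂ) ≠ 0 := by exact_mod_cast (by linarith [hρ1 n] : ρ n ≠ 0)
      rw [hcm _ θ, hcm (ρ n)⁻¹ θ]
      push_cast
      field_simp
    have hinv0 : ∀ n, 0 < (ρ n)⁻¹ := fun n => inv_pos.2 (by linarith [hρ1 n])
    have hinv1 : ∀ n, (ρ n)⁻¹ ≤ 1 := fun n => inv_le_one_of_one_le₀ (hρ1 n).le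
    have hnE : ∀ n (θ : ℝ), circleMap 0 (ρ n) θ ∉ E := fun n θ h => by
      have h1 : ‖circleMap 0 (ρ n) θ‖ = 1 := by simpa using hE h
      rw [norm_circleMap_zero, abs_of_pos (by linarith [hρ1 n])] at h1
      linarith [hρ1 n]
    refine intervalIntegral.tendsto_integral_filter_of_dominated_convergence (fun _ => 2 * (C₁ * C₂))
      (Eventually.of_forall fun n => ?_) (Eventually.of_forall fun n => ?_)
      intervalIntegrable_const ?_
    · have h2 : CircleIntegrable (fun z => g (z / (ρ n) ^ 2) • resolvent T z) 0 (ρ n) := by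
        have hρ0 : 0 < ρ n := by linarith [hρ1 n]
        refine ContinuousOn.circleIntegrable hρ0.le (ContinuousOn.smul ?_ fun z hz => ?_)
        · refine hgc.comp (by fun_prop) fun z hz => ?_
          have hz1 : ‖z‖ = ρ n := by simpa using hz
          rw [mem_closedBall_zero_iff, norm_div, norm_pow, norm_real, Real.norm_eq_abs,
            abs_of_pos hρ0, hz1, div_le_one (by positivity)]
          nlinarith [hρ1 n]
        · refine (hRc z fun h => ?_).continuousWithinAt
          have h1 : ‖z‖ = 1 := by simpa using hE h
          have hz1 : ‖z‖ = ρ n := by simpa using hz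
          linarith [hρ1 n]
      exact (intervalIntegrable_iff.1 h2.out).aestronglyMeasurable
    · refine Eventually.of_forall fun θ _ => ?_
      have hρ0 : 0 < ρ n := by linarith [hρ1 n]
      have h3 : ‖deriv (circleMap 0 (ρ n)) θ‖ = ρ n := by simp [abs_of_pos hρ0]
      beta_reduce
      rw [norm_smul, h3, hdiv, norm_smul]
      have hn : ‖circleMap 0 (ρ n) θ‖ = ρ n := by rw [norm_circleMap_zero, abs_of_pos hρ0]
      have h4 := hgC (circleMap 0 (ρ n)⁻¹ θ) (by
        rw [mem_closedBall_zero_iff, norm_circleMap_zero, abs_of_pos (hinv0 n)]; exact hinv1 n)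
      have h5 := hR (circleMap 0 (ρ n) θ) (hnE n θ) (by rw [hn]; exact (hρ1 n).le)
        (by rw [hn]; exact hρ2 n)
      have h6 := hE2 n θ
      have h7 : 0 ≤ infDist (circleMap 0 (ρ n)⁻¹ θ) E := infDist_nonneg
      have h8 : 0 ≤ infDist (circleMap 0 (ρ n) θ) E := infDist_nonneg
      calc ρ n * (‖g (circleMap 0 (ρ n)⁻¹ θ)‖ * ‖resolvent T (circleMap 0 (ρ n) θ)‖)
          ≤ 2 * ((C₁ * infDist (circleMap 0 (ρ n) θ) E ^ 3) *
              ‖resolvent T (circleMap 0 (ρ n) θ)‖) := by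
            gcongr
            · exact hρ2 n
            · refine h4.trans ?_
              gcongr
        _ = 2 * (C₁ * (‖resolvent T (circleMap 0 (ρ n) θ)‖ *
              infDist (circleMap 0 (ρ n) θ) E ^ 3)) := by ring
        _ ≤ _ := by gcongr
    · filter_upwards [hae] with θ hθ hmem
      simp only [deriv_circleMap, hdiv]
      have hinvt : Tendsto (fun n => (ρ n)⁻¹) atTop (nhds 1) := by
        have := hρt.inv₀ one_ne_zero
        rwa [inv_one] at this
      exact ((hct ρ θ hρt).mul_const I).smul ((hgt _ θ hinvt hinv0 hinv1).smul
        ((hRc _ (hθ hmem)).tendsto.comp (hct ρ θ hρt)))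
  rw [hin] at hout
  have hser : Tendsto (fun n => ∑' k, (a k * ((ρ n : ℂ) ^ 2)⁻¹ ^ k) • T ^ k) atTop
      (nhds (∑' k, a k • T ^ k)) := by
    refine tendsto_tsum_of_dominated_convergence hg.1 (fun k => ?_)
      (Eventually.of_forall fun n k => ?_)
    · have h1 : Tendsto (fun n => (ρ n : ℂ)) atTop (nhds ((1 : ℝ) : ℂ)) :=
        (continuous_ofReal.tendsto 1).comp hρt
      have h2 : Tendsto (fun n => a k * ((ρ n : ℂ) ^ 2)⁻¹ ^ k) atTop
          (nhds (a k * (((1 : ℝ) : ℂ) ^ 2)⁻¹ ^ k)) :=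
        (((h1.pow 2).inv₀ (by simp)).pow k).const_mul _
      simp only [ofReal_one, one_pow, inv_one, mul_one] at h2
      exact h2.smul_const _
    · have hρ0 : 0 < ρ n := by linarith [hρ1 n]
      rw [norm_smul, norm_mul, norm_pow, norm_inv, norm_pow, norm_real, Real.norm_eq_abs,
        abs_of_pos hρ0]
      have h1 : (ρ n ^ 2)⁻¹ ^ k ≤ 1 :=
        pow_le_one₀ (by positivity) (inv_le_one_of_one_le₀ (one_le_pow₀ (hρ1 n).le))
      calc ‖a k‖ * (ρ n ^ 2)⁻¹ ^ k * ‖T ^ k‖ ≤ ‖a k‖ * 1 * 1 := by gcongr; exact hT k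
        _ = ‖a k‖ := by ring
  have h1 : Tendsto (fun n => ∮ z in C(0, ρ n), g (z / (ρ n) ^ 2) • resolvent T z) atTop
      (nhds ((2 * Real.pi * I : ℂ) • ∑' k, a k • T ^ k)) := by
    rw [funext fun n => circleIntegral_smul_resolvent hT hg (hρ1 n)]
    exact hser.const_smul _
  have h2 := tendsto_nhds_unique hout h1
  exact (smul_eq_zero.1 h2.symm).resolve_left two_pi_I_ne_zero

end Contour

theorem IsAPlusCoeff.differentiableOn {f : ℂ → ℂ} {a : ℕ → ℂ} (h : IsAPlusCoeff f a) :
    DifferentiableOn ℂ f (ball 0 1) := by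
  have h1 : DifferentiableOn ℂ (fun z => ∑' n, a n * z ^ n) (ball (0 : ℂ) 1) := by
    refine differentiableOn_tsum_of_summable_norm h.1 (fun n => ?_) isOpen_ball fun n z hz => ?_
    · fun_prop
    · rw [mem_ball_zero_iff] at hz
      rw [norm_mul, norm_pow]
      exact mul_le_of_le_one_right (norm_nonneg _) (pow_le_one₀ (norm_nonneg _) hz.le)
  exact h1.congr fun z hz => ((h.2 z (ball_subset_closedBall hz)).tsum_eq).symm

theorem IsAPlusCoeff.norm_le {f : ℂ → ℂ} {a : ℕ → ℂ} (h : IsAPlusCoeff f a) {z : ℂ}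
    (hz : z ∈ closedBall (0 : ℂ) 1) : ‖f z‖ ≤ ∑' n, ‖a n‖ := by
  rw [← (h.2 z hz).tsum_eq]
  refine tsum_of_norm_bounded h.1.hasSum fun n => ?_
  rw [mem_closedBall_zero_iff] at hz
  rw [norm_mul, norm_pow]
  exact mul_le_of_le_one_right (norm_nonneg _) (pow_le_one₀ (norm_nonneg _) hz)

section Gcd

variable {B : Type*} [NormedRing B] [NormedAlgebra ℂ B] [CompleteSpace B] {T : B}

theorem exists_norm_smul_resolvent_le (hT : ∀ n, ‖T ^ n‖ ≤ 1) {E : Set ℂ}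
    (hE : E ⊆ sphere 0 1) (hE0 : volume {θ : ℝ | θ ∈ Ioc 0 (2 * Real.pi) ∧ circleMap 0 1 θ ∈ E} = 0)
    (hres : ∀ l ∉ E, l ∈ resolventSet ℂ T) {I : Set (ℂ → ℂ)}
    (hI : ∀ f ∈ I, ∃ a, IsAPlusCoeff f a ∧ ∑' n, a n • T ^ n = 0) (hhull : hull I ⊆ E)
    (hSI : IsGcdInner I fun _ => 1) {g : ℂ → ℂ} (hgc : ContinuousOn g (closedBall 0 1))
    (hgd : DifferentiableOn ℂ g (ball 0 1)) {C₁ C : ℝ}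
    (hgC : ∀ z ∈ closedBall (0 : ℂ) 1, ‖g z‖ ≤ C₁ * infDist z E ^ 3) (hC1 : 1 ≤ C)
    (hR : ∀ l ∉ E, 1 ≤ ‖l‖ → ‖l‖ ≤ 2 → ‖resolvent T l‖ * infDist l E ^ 3 ≤ C)
    (hRw : ∀ l : ℂ, ‖l‖ < 1 → ∀ (c : ℂ) (K : ℝ), ‖c‖ ≤ K →
      ‖c • resolvent T l‖ ≤ K / (1 - ‖l‖) → ‖c • resolvent T l‖ * infDist l E ^ 3 ≤ C * K) :
    ∃ M, ∀ z ∈ ball (0 : ℂ) 1, ‖g z • resolvent T z‖ ≤ M := by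
  have hbE : ∀ z ∈ ball (0 : ℂ) 1, z ∉ E := fun z hz h => by
    have h1 : ‖z‖ = 1 := by simpa using hE h
    have h2 : ‖z‖ < 1 := by simpa using hz
    linarith
  have hRd : ∀ l ∉ E, DifferentiableAt ℂ (resolvent T) l := fun l hl =>
    differentiableOn_resolvent.differentiableAt
      ((spectrum.isOpen_resolventSet T).mem_nhds (hres l hl))
  have hnz : ∀ z ∈ ball (0 : ℂ) 1, ∃ f ∈ I, f z ≠ 0 := fun z hz => by
    by_contra! h
    exact hbE z hz (hhull ⟨ball_subset_closedBall hz, h⟩)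
  have hg' : ∀ z ∈ closedBall (0 : ℂ) 1, ‖g z‖ ≤ (|C₁| + 1) * infDist z E ^ 3 := fun z hz => by
    refine (hgC z hz).trans ?_
    have : 0 ≤ infDist z E := infDist_nonneg
    gcongr
    linarith [le_abs_self C₁]
  set D : ℝ := (|C₁| + 1) * C with hD
  have hD0 : 0 < D := by positivity
  set κ : ℝ := 1 / (2 * D) with hκ
  have hκ0 : 0 < κ := by positivity
  have hκD : κ * D = 1 / 2 := by rw [hκ]; field_simp
  have hκn : ‖(κ : ℂ)‖ = κ := by rw [norm_real, Real.norm_eq_abs, abs_of_pos hκ0]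
  set ψ : ℂ → B := fun z => (κ : ℂ) • (g z • resolvent T z) with hψ
  have hψd : DifferentiableOn ℂ ψ (ball 0 1) :=
    (hgd.smul fun z hz => (hRd z (hbE z hz)).differentiableWithinAt).const_smul (κ : ℂ)
  have hfψ : ∀ f ∈ I, ∃ K, DifferentiableOn ℂ f (ball 0 1) ∧ (∀ z ∈ ball (0 : ℂ) 1, ‖f z‖ ≤ K) ∧
      ∀ z ∈ ball (0 : ℂ) 1, ‖f z • ψ z‖ ≤ K := by
    intro f hf
    obtain ⟨a, ha, haT⟩ := hI f hf
    refine ⟨∑' n, ‖a n‖, ha.differentiableOn, fun z hz => ha.norm_le (ball_subset_closedBall hz),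
      fun z hz => ?_⟩
    have hz1 : ‖z‖ < 1 := by simpa using hz
    have h1 := norm_tsum_smul_resolvent_le hT ha.1 haT hz1 (hres z (hbE z hz))
    rw [(ha.2 z (ball_subset_closedBall hz)).tsum_eq] at h1
    have h2 := hRw z hz1 (f z) _ (ha.norm_le (ball_subset_closedBall hz)) h1
    have h3 : f z • ψ z = ((κ : ℂ) * g z) • (f z • resolvent T z) := by
      simp only [hψ, smul_smul]
      congr 1
      ring
    have hK : 0 ≤ ∑' n, ‖a n‖ := tsum_nonneg fun _ => norm_nonneg _
    rw [h3, norm_smul, norm_mul, hκn]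
    calc κ * ‖g z‖ * ‖f z • resolvent T z‖
        ≤ κ * ((|C₁| + 1) * infDist z E ^ 3) * ‖f z • resolvent T z‖ := by
          gcongr
          exact hg' z (ball_subset_closedBall hz)
      _ = κ * ((|C₁| + 1) * (‖f z • resolvent T z‖ * infDist z E ^ 3)) := by ring
      _ ≤ κ * ((|C₁| + 1) * (C * ∑' n, ‖a n‖)) := by gcongr
      _ = (κ * D) * ∑' n, ‖a n‖ := by rw [hD]; ring
      _ ≤ 1 * ∑' n, ‖a n‖ := by rw [hκD]; gcongr; norm_num
      _ = _ := one_mul _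
  obtain ⟨f₀, hf₀I, hf₀0⟩ := hnz 0 (mem_ball_self one_pos)
  obtain ⟨K₀, hf₀d, hf₀K, hf₀ψ⟩ := hfψ f₀ hf₀I
  obtain ⟨s, hsd, hs1, hsψ, hsf, hsb⟩ := exists_holomorphic_minorant hψd hf₀d hf₀0 hf₀K hf₀ψ
  have hs0 : ∀ z ∈ ball (0 : ℂ) 1, s z ≠ 0 := by
    intro z hz h
    obtain ⟨f, hf, hfz⟩ := hnz z hz
    obtain ⟨K, hfd, hfK, hfψK⟩ := hfψ f hf
    have := hsf f K hfd hfK hfψK z hz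
    rw [h, norm_zero, mul_zero] at this
    exact hfz (norm_le_zero_iff.1 this)
  have hψζ : ∀ ζ ∈ sphere (0 : ℂ) 1, ζ ∉ E →
      ∃ δ > 0, ∀ z ∈ ball (0 : ℂ) 1, ‖z - ζ‖ < δ → ‖ψ z‖ ≤ 1 := by
    intro ζ hζ hζE
    have hζc : ζ ∈ closedBall (0 : ℂ) 1 := sphere_subset_closedBall hζ
    have hζn : ‖ζ‖ = 1 := by simpa using hζ
    have h1 : ContinuousWithinAt ψ (closedBall 0 1) ζ :=
      ((hgc ζ hζc).smul (hRd ζ hζE).continuousAt.continuousWithinAt).const_smul (κ : ℂ)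
    have h2 : ‖ψ ζ‖ < 1 := by
      simp only [hψ]
      rw [norm_smul, norm_smul, hκn]
      calc κ * (‖g ζ‖ * ‖resolvent T ζ‖)
          ≤ κ * (((|C₁| + 1) * infDist ζ E ^ 3) * ‖resolvent T ζ‖) := by
            gcongr
            exact hg' ζ hζc
        _ = κ * ((|C₁| + 1) * (‖resolvent T ζ‖ * infDist ζ E ^ 3)) := by ring
        _ ≤ κ * ((|C₁| + 1) * C) := by
            gcongr
            exact hR ζ hζE hζn.ge (by linarith)
        _ < 1 := by rw [← hD, hκD]; norm_num
    have h3 := h1.norm.eventually_lt_const h2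
    rw [Filter.Eventually, mem_nhdsWithin_iff] at h3
    obtain ⟨δ, hδ, hδs⟩ := h3
    refine ⟨δ, hδ, fun z hz hzδ => ?_⟩
    have : z ∈ {x | ‖ψ x‖ < 1} :=
      hδs ⟨by rwa [mem_ball, dist_eq_norm], ball_subset_closedBall hz⟩
    exact le_of_lt this
  have hsin : IsInnerFunction s := by
    refine ⟨hsd, hs1, ?_⟩
    rw [ae_restrict_iff' measurableSet_Ioc, ae_iff]
    refine measure_mono_null (fun θ hθ => ?_) hE0
    simp only [mem_ofPred_eq, Classical.not_imp] at hθ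
    refine ⟨hθ.1, ?_⟩
    by_contra hθE
    have hc : circleMap 0 1 θ = Complex.exp (θ * Complex.I) := by simp [circleMap]
    have hm : circleMap 0 1 θ ∈ sphere (0 : ℂ) 1 := circleMap_mem_sphere 0 zero_le_one θ
    refine hθ.2 ?_
    rw [← hc]
    exact hsb _ hm (hψζ _ hm hθE)
  obtain ⟨q, ⟨-, Cq, hq⟩, hsq⟩ := hSI.2.2 s hsin fun f hf _ => by
    obtain ⟨K, hfd, hfK, hfψK⟩ := hfψ f hf
    refine ⟨fun z => f z / s z, ⟨hfd.div hsd hs0, K, fun z hz => ?_⟩, fun z hz => ?_⟩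
    · rw [norm_div, div_le_iff₀ (norm_pos_iff.2 (hs0 z hz))]
      exact hsf f K hfd hfK hfψK z hz
    · rw [mul_div_cancel₀ _ (hs0 z hz)]
  refine ⟨Cq / κ, fun z hz => ?_⟩
  have h1 : ψ z = q z • (s z • ψ z) := by
    rw [smul_smul, mul_comm, ← hsq z hz, one_smul]
  have h2 : ‖ψ z‖ ≤ Cq * 1 := by
    rw [h1, norm_smul]
    exact mul_le_mul (hq z hz) (hsψ z hz) (norm_nonneg _) ((norm_nonneg _).trans (hq z hz))
  rw [le_div_iff₀ hκ0]
  have h3 : ‖ψ z‖ = κ * ‖g z • resolvent T z‖ := by rw [hψ, norm_smul, hκn]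
  linarith

end Gcd

/-- If `g ∈ A⁺` is smooth up to the boundary and flat on `E`, then it belongs to every closed
ideal with trivial inner factor whose hull is contained in `E`. -/
theorem VanishAllDeriv.mem_of_isGcdInner_one {E : Set ℂ} (hEc : IsClosed E) (hE : E ⊆ sphere 0 1)
    {I : Set (ℂ → ℂ)} (hI : IsClosedIdealAPlus I) (hne : NontrivialIdeal I)
    (hSI : IsGcdInner I fun _ => 1) (hhull : hull I ⊆ E) {g : ℂ → ℂ} (hgA : g ∈ APlus)
    (hg : VanishAllDeriv E g) : g ∈ I := by
  obtain ⟨b, hb⟩ : ∃ b, IsAPlusCoeff g b := hgA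
  obtain ⟨f₁, hf₁, -⟩ := hne
  obtain ⟨B, _, _, _, T, hT, hmodel⟩ := hI.exists_model ⟨f₁, hf₁⟩
  have hIa : ∀ f ∈ I, ∃ a, IsAPlusCoeff f a ∧ ∑' n, a n • T ^ n = 0 := fun f hf => by
    obtain ⟨a, ha⟩ : ∃ a, IsAPlusCoeff f a := hI.1 hf
    exact ⟨a, ha, (hmodel f a ha).2 hf⟩
  have hres : ∀ l ∉ E, l ∈ resolventSet ℂ T := fun l hl => by
    rcases le_or_gt ‖l‖ 1 with h | h
    · have hlc : l ∈ closedBall (0 : ℂ) 1 := by simpa using h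
      obtain ⟨f, hf, hfl⟩ : ∃ f ∈ I, f l ≠ 0 := by
        by_contra! hcon
        exact hl (hhull ⟨hlc, hcon⟩)
      obtain ⟨a, ha, haT⟩ := hIa f hf
      exact mem_resolventSet_of_tsum_ne_zero hT ha.1 haT h (by rwa [(ha.2 l hlc).tsum_eq])
    · exact mem_resolventSet_of_one_lt hT h
  rw [← hmodel g b hb]
  rcases E.eq_empty_or_nonempty with rfl | hEne
  · rcases subsingleton_or_nontrivial B with _ | _
    · exact Subsingleton.elim _ _
    · obtain ⟨l, hl⟩ := spectrum.nonempty T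
      exact absurd (hres l (notMem_empty l)) hl
  by_cases hg0 : ∀ z ∈ ball (0 : ℂ) 1, g z = 0
  · have h1 : EqOn g (fun _ => 0) (closedBall 0 1) :=
      EqOn.of_subset_closure hg0 hg.1 continuousOn_const ball_subset_closedBall
        (closure_ball (0 : ℂ) one_ne_zero).ge
    have h2 : IsAPlusCoeff g 0 := ⟨by simp, fun z hz => by
      rw [h1 hz]
      simp⟩
    rw [hmodel g b hb, ← hmodel g 0 h2]
    simp
  push Not at hg0
  obtain ⟨z₀, hz₀, hgz₀⟩ := hg0
  have hbE : ∀ z ∈ ball (0 : ℂ) 1, z ∉ E := fun z hz h => by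
    have h1 : ‖z‖ = 1 := by simpa using hE h
    have h2 : ‖z‖ < 1 := by simpa using hz
    linarith
  have hexp : ∃ C, ∀ z ∈ ball (0 : ℂ) 1, ‖resolvent T z‖ ≤ Real.exp (C / (1 - ‖z‖) ^ 2) := by
    have h0 : (0 : ℂ) ∈ ball (0 : ℂ) 1 := mem_ball_self one_pos
    obtain ⟨f, hf, hf0⟩ : ∃ f ∈ I, f 0 ≠ 0 := by
      by_contra! hcon
      exact hbE 0 h0 (hhull ⟨ball_subset_closedBall h0, hcon⟩)
    obtain ⟨a, ha, haT⟩ := hIa f hf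
    refine exists_norm_le_exp (K := ∑' n, ‖a n‖)
      (differentiableOn_resolvent.mono fun z hz => hres z (hbE z hz)) ha.differentiableOn
      (fun z hz => ha.norm_le (ball_subset_closedBall hz)) (fun z hz => ?_) hf0
    rw [← (ha.2 z (ball_subset_closedBall hz)).tsum_eq]
    exact norm_tsum_smul_resolvent_le hT ha.1 haT (by simpa using hz) (hres z (hbE z hz))
  obtain ⟨C, hC1, hR, hRw⟩ := exists_resolvent_growth_weighted hT hEc hEne hE hres hexp
  obtain ⟨C₁, hgC⟩ := hg.exists_norm_le_infDist_pow hEc hEne (hE.trans sphere_subset_closedBall) 3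
  have hE0 := volume_circle_zeros_eq_zero hg.1 hg.2.1 hEc hE hg.2.2.1 hz₀ hgz₀
  obtain ⟨M, hM⟩ := exists_norm_smul_resolvent_le hT hE hE0 hres hIa hhull hSI hg.1 hg.2.1 hgC hC1
    hR hRw
  exact tsum_smul_pow_eq_zero hT hEne hE hE0 hres hb hg.1 hg.2.1 hgC hR hM

/-- If `E` is a Carleson set, then `J₀⁺(E) ⊆ I` for every closed ideal
`I ≠ {0}` of `A⁺` with `S_I = 1` and `h(I) ⊆ E`. -/
theorem stmt_5 (E : Set ℂ) (hE : IsCarleson E)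
    (I : Set (ℂ → ℂ)) (hI : IsClosedIdealAPlus I) (hne : NontrivialIdeal I)
    (hSI : IsGcdInner I (fun _ => 1)) (hhull : hull I ⊆ E) :
    J0Plus E ⊆ I := by
  rintro f ⟨hfA, hf⟩
  refine hI.2.2.2 f hfA fun ε hε => ?_
  obtain ⟨g, hgA, hg, hfg⟩ := hf ε hε
  exact ⟨g, hg.mem_of_isGcdInner_one hE.1 hE.2.1 hI hne hSI hhull hgA, hfg⟩
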